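/- arXiv:2401.06111 — 4 statements merged into one kernel-verified Lean document; each statement's English description precedes it below -/
import Mathlib

section
/- For every triple of non-negative integers (A, B, C) with AC ≤ B², there exist lattice polytopes P, Q ⊂ ℝ² such that the normalized volume polynomial satisfies Vol₂(xP + yQ) = Ax² + 2Bxy + Cy² for all x, y ≥ 0; equivalently, Vol₂(P) = A, V(P,Q) = B, and Vol₂(Q) = C. -/
open Pointwise MeasureTheory

/-- The embedding of `ℤ²` into `ℝ²`. -/
def toR2 (p : ℤ × ℤ) : ℝ × ℝ := ((p.1 : ℝ), (p.2 : ℝ))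

/-- A lattice polygon: the convex hull of a non-empty finite set of points of `ℤ²`. -/
def IsLatticePolygon (S : Set (ℝ × ℝ)) : Prop :=
  ∃ F : Finset (ℤ × ℤ), F.Nonempty ∧ S = convexHull ℝ (toR2 '' ↑F)

/-- The normalized volume: twice the Euclidean area. -/
noncomputable def nvol (S : Set (ℝ × ℝ)) : ℝ := 2 * (volume S).toReal

/-- The normalized mixed volume `V(P,Q) = (Vol₂(P+Q) - Vol₂(P) - Vol₂(Q))/2`. -/
noncomputable def mixedVol (P Q : Set (ℝ × ℝ)) : ℝ :=
  (nvol (P + Q) - nvol P - nvol Q) / 2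

/-- A linear inequality on a set passes to its convex hull. -/
lemma hull_le {S : Set (ℝ × ℝ)} (α β γ : ℝ) (hS : ∀ p ∈ S, α * p.1 + β * p.2 ≤ γ) :
    ∀ p ∈ convexHull ℝ S, α * p.1 + β * p.2 ≤ γ := by
  have hc : Convex ℝ {p : ℝ × ℝ | α * p.1 + β * p.2 ≤ γ} := by
    intro p hp q hq a b ha hb hab
    simp only [Set.mem_ofPred_eq, Prod.fst_add, Prod.snd_add, Prod.smul_fst, Prod.smul_snd,
      smul_eq_mul] at *
    have h1 := mul_le_mul_of_nonneg_left hp ha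
    have h2 := mul_le_mul_of_nonneg_left hq hb
    have h3 : a * γ + b * γ = γ := by rw [← add_mul, hab, one_mul]
    linarith
  exact fun p hp => convexHull_min (fun p hp => hS p hp) hc hp

lemma toR2_image_add (F G : Finset (ℤ × ℤ)) :
    toR2 '' (↑(F + G) : Set (ℤ × ℤ)) = toR2 '' ↑F + toR2 '' ↑G := by
  let f : (ℤ × ℤ) →+ (ℝ × ℝ) :=
    { toFun := toR2
      map_zero' := by simp [toR2]
      map_add' := by intro p q; simp [toR2] }
  have : toR2 = f := rfl
  rw [this, Finset.coe_add, Set.image_add]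

lemma IsLatticePolygon.add {P Q : Set (ℝ × ℝ)} (hP : IsLatticePolygon P)
    (hQ : IsLatticePolygon Q) : IsLatticePolygon (P + Q) := by
  obtain ⟨F, hF, rfl⟩ := hP
  obtain ⟨G, hG, rfl⟩ := hQ
  exact ⟨F + G, hF.add hG, by rw [toR2_image_add, convexHull_add]⟩

lemma IsLatticePolygon.convex {P : Set (ℝ × ℝ)} (hP : IsLatticePolygon P) : Convex ℝ P := by
  obtain ⟨F, hF, rfl⟩ := hP
  exact convex_convexHull _ _

lemma IsLatticePolygon.nonempty {P : Set (ℝ × ℝ)} (hP : IsLatticePolygon P) : P.Nonempty := by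
  obtain ⟨F, hF, rfl⟩ := hP
  exact (Set.Nonempty.image _ (by exact_mod_cast hF)).convexHull

/-- The triangle of height one over a base of length `A`. -/
def triF (A : ℤ) : Finset (ℤ × ℤ) := {(0, 0), (0, A), (1, 0)}

/-- The trapezoid of height one with parallel sides `[u,B]` and `[0,w]`. -/
def trapF (B u w : ℤ) : Finset (ℤ × ℤ) := {(0, u), (0, B), (1, 0), (1, w)}

lemma exists_ratio {s x : ℝ} (h0 : 0 ≤ s) (h1 : s ≤ x) : ∃ t, 0 ≤ t ∧ t ≤ 1 ∧ s = x * t := by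
  rcases eq_or_lt_of_le (h0.trans h1) with hx | hx
  · exact ⟨0, le_rfl, zero_le_one, by linarith⟩
  · exact ⟨s / x, by positivity, (div_le_one hx).2 h1, by field_simp⟩

lemma mem_sum {P Q : Set (ℝ × ℝ)} {x y : ℝ} {p q : ℝ × ℝ} (hp : p ∈ P) (hq : q ∈ Q)
    {s a : ℝ} (hs : s = x * p.1 + y * q.1) (ha : a = x * p.2 + y * q.2) :
    (s, a) ∈ x • P + y • Q := by
  refine Set.mem_add.2 ⟨x • p, Set.smul_mem_smul_set hp, y • q, Set.smul_mem_smul_set hq, ?_⟩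
  ext <;> simp [hs, ha]

lemma hull_comb {S : Set (ℝ × ℝ)} {p q : ℝ × ℝ} (hp : p ∈ S) (hq : q ∈ S) {t : ℝ}
    (h0 : 0 ≤ t) (h1 : t ≤ 1) :
    ((1 - t) * p.1 + t * q.1, (1 - t) * p.2 + t * q.2) ∈ convexHull ℝ S := by
  have := convex_convexHull ℝ S (subset_convexHull ℝ S hp) (subset_convexHull ℝ S hq)
    (sub_nonneg.2 h1) h0 (by ring)
  convert this using 1
  ext <;> simp

/-- The Minkowski sum of the dilated triangle and trapezoid, by inequalities. -/
lemma region_eq (A B u w : ℕ) (h1 : A + w ≤ B) (h2 : u ≤ B) (x y : ℝ) (hx : 0 ≤ x)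
    (hy : 0 ≤ y) :
    x • convexHull ℝ (toR2 '' ↑(triF A)) + y • convexHull ℝ (toR2 '' ↑(trapF B u w)) =
      {p : ℝ × ℝ | p.1 ∈ Set.Icc 0 (x + y) ∧
        p.2 ∈ Set.Icc (max (u * (y - p.1)) 0)
          (min (x * A + y * B - A * p.1) (y * w + (B - w) * (x + y - p.1)))} := by
  have h1' : (A : ℝ) + w ≤ B := by exact_mod_cast h1
  have h2' : (u : ℝ) ≤ B := by exact_mod_cast h2
  have hA : (0 : ℝ) ≤ A := Nat.cast_nonneg _
  have hu : (0 : ℝ) ≤ u := Nat.cast_nonneg _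
  have hw : (0 : ℝ) ≤ w := Nat.cast_nonneg _
  have hPi : toR2 '' (↑(triF A) : Set (ℤ × ℤ)) = {(0, 0), (0, (A : ℝ)), (1, 0)} := by
    simp [triF, toR2, Set.image_insert_eq]
  have hQi : toR2 '' (↑(trapF B u w) : Set (ℤ × ℤ)) =
      {(0, (u : ℝ)), (0, (B : ℝ)), (1, 0), (1, (w : ℝ))} := by
    simp [trapF, toR2, Set.image_insert_eq]
  rw [hPi, hQi]
  set SP : Set (ℝ × ℝ) := {(0, 0), (0, (A : ℝ)), (1, 0)} with hSP
  set SQ : Set (ℝ × ℝ) := {(0, (u : ℝ)), (0, (B : ℝ)), (1, 0), (1, (w : ℝ))} with hSQ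
  have p1 : ((0 : ℝ), (0 : ℝ)) ∈ SP := by simp [hSP]
  have p2 : ((0 : ℝ), (A : ℝ)) ∈ SP := by simp [hSP]
  have p3 : ((1 : ℝ), (0 : ℝ)) ∈ SP := by simp [hSP]
  have q1 : ((0 : ℝ), (u : ℝ)) ∈ SQ := by simp [hSQ]
  have q2 : ((0 : ℝ), (B : ℝ)) ∈ SQ := by simp [hSQ]
  have q3 : ((1 : ℝ), (0 : ℝ)) ∈ SQ := by simp [hSQ]
  have q4 : ((1 : ℝ), (w : ℝ)) ∈ SQ := by simp [hSQ]
  apply Set.Subset.antisymm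
  · intro z hz
    obtain ⟨_, ⟨p, hp, rfl⟩, _, ⟨q, hq, rfl⟩, rfl⟩ := Set.mem_add.1 hz
    have a1 := hull_le (-1) 0 0 (by simp [hSP]) p hp
    have a2 := hull_le 0 (-1) 0 (by simp [hSP]) p hp
    have a3 := hull_le A 1 A (by simp [hSP]) p hp
    have b1 := hull_le (-1) 0 0 (by simp [hSQ]) q hq
    have b2 := hull_le 1 0 1 (by simp [hSQ]) q hq
    have b3 := hull_le (-u) (-1) (-u) (by simp [hSQ]; linarith) q hq
    have b4 := hull_le (B - w) 1 B (by simp [hSQ]; exact h2) q hq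
    have b5 := hull_le 0 (-1) 0 (by simp [hSQ]) q hq
    have a4 : p.1 ≤ 1 := by
      have := hull_le 1 0 1 (by simp [hSP]) p hp
      linarith
    have x1 := mul_le_mul_of_nonneg_left a1 hx
    have x2 := mul_le_mul_of_nonneg_left a2 hx
    have x3 := mul_le_mul_of_nonneg_left a3 hx
    have x4 := mul_le_mul_of_nonneg_left a4 hx
    have y1 := mul_le_mul_of_nonneg_left b1 hy
    have y2 := mul_le_mul_of_nonneg_left b2 hy
    have y3 := mul_le_mul_of_nonneg_left b3 hy
    have y4 := mul_le_mul_of_nonneg_left b4 hy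
    have y5 := mul_le_mul_of_nonneg_left b5 hy
    have k1 : 0 ≤ u * (x * p.1) := mul_nonneg hu (by linarith)
    have k2 : 0 ≤ (B - w - A) * (y * q.1) := mul_nonneg (by linarith) (by linarith)
    have k3 : 0 ≤ (B - w - A) * (x * (1 - p.1)) :=
      mul_nonneg (by linarith) (mul_nonneg hx (by linarith))
    simp only [Set.mem_ofPred_eq, Prod.fst_add, Prod.snd_add, Prod.smul_fst, Prod.smul_snd,
      smul_eq_mul, Set.mem_Icc, max_le_iff, le_min_iff]
    refine ⟨⟨by linarith, by linarith⟩, ⟨by linarith, by linarith⟩, by linarith, by linarith⟩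
  · rintro ⟨s, a⟩ ⟨⟨hs0, hs1⟩, ha0, ha1⟩
    simp only at hs0 hs1 ha0 ha1
    have hconv : Convex ℝ (x • convexHull ℝ SP + y • convexHull ℝ SQ) :=
      ((convex_convexHull ℝ SP).smul x).add ((convex_convexHull ℝ SQ).smul y)
    have hl : (s, max (u * (y - s)) 0) ∈ x • convexHull ℝ SP + y • convexHull ℝ SQ := by
      rcases le_total s y with h | h
      · obtain ⟨t, t0, t1, rfl⟩ := exists_ratio hs0 h
        rw [max_eq_left (mul_nonneg hu (by linarith))]
        exact mem_sum (subset_convexHull ℝ _ p1) (hull_comb q1 q3 t0 t1) (by ring) (by ring)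
      · obtain ⟨t, t0, t1, ht⟩ := exists_ratio (s := s - y) (x := x) (by linarith) (by linarith)
        rw [max_eq_right (mul_nonpos_of_nonneg_of_nonpos hu (by linarith))]
        refine mem_sum (hull_comb p1 p3 t0 t1) (subset_convexHull ℝ _ q3) ?_ (by ring)
        simp only
        linarith
    have hr : (s, min (x * A + y * B - A * s) (y * w + (B - w) * (x + y - s))) ∈
        x • convexHull ℝ SP + y • convexHull ℝ SQ := by
      rcases le_total s x with h | h
      · have : 0 ≤ (B - w - A) * (x - s) := mul_nonneg (by linarith) (by linarith)
        rw [min_eq_left (by linarith)]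
        obtain ⟨t, t0, t1, rfl⟩ := exists_ratio hs0 h
        exact mem_sum (hull_comb p2 p3 t0 t1) (subset_convexHull ℝ _ q2) (by ring) (by ring)
      · have : 0 ≤ (B - w - A) * (s - x) := mul_nonneg (by linarith) (by linarith)
        rw [min_eq_right (by linarith)]
        obtain ⟨t, t0, t1, ht⟩ := exists_ratio (s := s - x) (x := y) (by linarith) (by linarith)
        obtain rfl : s = x + y * t := by linarith
        exact mem_sum (subset_convexHull ℝ _ p3) (hull_comb q2 q4 t0 t1) (by ring) (by ring)
    obtain ⟨c, d, hc, hd, hcd, hac⟩ := (Convex.mem_Icc (ha0.trans ha1)).1 ⟨ha0, ha1⟩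
    have := hconv hl hr hc hd hcd
    convert this using 1
    ext
    · simp [← add_mul, hcd]
    · simp [← hac]

/-- The area of a region between two continuous graphs (closed version). -/
lemma vol_region {f g : ℝ → ℝ} (hf : Continuous f) (hg : Continuous g) {b : ℝ} (hb : 0 ≤ b)
    (hfg : ∀ s ∈ Set.Icc 0 b, f s ≤ g s) :
    (volume {p : ℝ × ℝ | p.1 ∈ Set.Icc 0 b ∧ p.2 ∈ Set.Icc (f p.1) (g p.1)}).toReal =
      ∫ s in (0 : ℝ)..b, (g s - f s) := by
  have hm : MeasurableSet {p : ℝ × ℝ | p.1 ∈ Set.Icc 0 b ∧ p.2 ∈ Set.Icc (f p.1) (g p.1)} := by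
    apply IsClosed.measurableSet
    simp only [Set.mem_Icc, Set.ofPred_and]
    refine IsClosed.inter (IsClosed.inter ?_ ?_) (IsClosed.inter ?_ ?_) <;>
      exact isClosed_le (by fun_prop) (by fun_prop)
  rw [Measure.volume_eq_prod, Measure.prod_apply hm]
  have : (fun s => volume (Prod.mk s ⁻¹'
      {p : ℝ × ℝ | p.1 ∈ Set.Icc 0 b ∧ p.2 ∈ Set.Icc (f p.1) (g p.1)})) =
      (Set.Icc 0 b).indicator (fun s => ENNReal.ofReal (g s - f s)) := by
    ext s
    by_cases hs : s ∈ Set.Icc 0 b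
    · rw [Set.indicator_of_mem hs, ← Real.volume_Icc]
      congr 1
      ext a
      simp only [Set.mem_preimage, Set.mem_ofPred_eq, hs, true_and]
    · rw [Set.indicator_of_notMem hs]
      simp only [Set.preimage_ofPred_eq, hs, false_and, Set.ofPred_false, measure_empty]
  rw [this, lintegral_indicator measurableSet_Icc, intervalIntegral.integral_of_le hb,
    ← integral_Icc_eq_integral_Ioc, integral_eq_lintegral_of_nonneg_ae]
  · exact (ae_restrict_iff' measurableSet_Icc).2
      (Filter.Eventually.of_forall fun s hs => sub_nonneg.2 (hfg s hs))
  · exact (hg.sub hf).aestronglyMeasurable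

lemma integral_affine (a b c d : ℝ) :
    ∫ s in a..b, (c + d * s) = c * (b - a) + d * (b ^ 2 - a ^ 2) / 2 := by
  rw [intervalIntegral.integral_add
    (by apply Continuous.intervalIntegrable; fun_prop) (by apply Continuous.intervalIntegrable; fun_prop),
    intervalIntegral.integral_const, intervalIntegral.integral_const_mul, integral_id]
  simp only [smul_eq_mul]
  ring

lemma base_vol (A B u w : ℕ) (h1 : A + w ≤ B) (h2 : u ≤ B) (x y : ℝ) (hx : 0 ≤ x)
    (hy : 0 ≤ y) :
    nvol (x • convexHull ℝ (toR2 '' ↑(triF A)) + y • convexHull ℝ (toR2 '' ↑(trapF B u w))) =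
      (A : ℝ) * x ^ 2 + 2 * (B : ℝ) * x * y + ((B : ℝ) + w - u) * y ^ 2 := by
  have h1' : (A : ℝ) + w ≤ B := by exact_mod_cast h1
  have h2' : (u : ℝ) ≤ B := by exact_mod_cast h2
  have hA : (0 : ℝ) ≤ A := Nat.cast_nonneg _
  have hu : (0 : ℝ) ≤ u := Nat.cast_nonneg _
  have hw : (0 : ℝ) ≤ w := Nat.cast_nonneg _
  rw [nvol, region_eq A B u w h1 h2 x y hx hy,
    vol_region (f := fun s => max (u * (y - s)) 0)
      (g := fun s => min (x * A + y * B - A * s) (y * w + (B - w) * (x + y - s)))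
      (by fun_prop) (by fun_prop) (by linarith)]
  · rw [intervalIntegral.integral_sub (by apply Continuous.intervalIntegrable; fun_prop)
      (by apply Continuous.intervalIntegrable; fun_prop)]
    rw [← intervalIntegral.integral_add_adjacent_intervals (a := 0) (b := x) (c := x + y)
      (f := fun s => min (x * A + y * B - A * s) (y * w + (B - w) * (x + y - s)))
      (by apply Continuous.intervalIntegrable; fun_prop)
      (by apply Continuous.intervalIntegrable; fun_prop)]
    rw [← intervalIntegral.integral_add_adjacent_intervals (a := 0) (b := y) (c := x + y)
      (f := fun s => max (u * (y - s)) 0)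
      (by apply Continuous.intervalIntegrable; fun_prop)
      (by apply Continuous.intervalIntegrable; fun_prop)]
    have e1 : ∫ s in (0 : ℝ)..x,
        min (x * A + y * B - A * s) (y * w + (B - w) * (x + y - s)) =
        ∫ s in (0 : ℝ)..x, ((x * A + y * B) + (-A) * s) := by
      apply intervalIntegral.integral_congr
      intro s hs
      rw [Set.uIcc_of_le hx] at hs
      have : 0 ≤ (B - w - A) * (x - s) := mul_nonneg (by linarith) (by linarith [hs.2])
      simp only
      rw [min_eq_left (by linarith)]
      ring
    have e2 : ∫ s in x..(x + y),
        min (x * A + y * B - A * s) (y * w + (B - w) * (x + y - s)) =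
        ∫ s in x..(x + y), ((y * w + (B - w) * (x + y)) + (-(B - w)) * s) := by
      apply intervalIntegral.integral_congr
      intro s hs
      rw [Set.uIcc_of_le (by linarith)] at hs
      have : 0 ≤ (B - w - A) * (s - x) := mul_nonneg (by linarith) (by linarith [hs.1])
      simp only
      rw [min_eq_right (by linarith)]
      ring
    have e3 : ∫ s in (0 : ℝ)..y, max (u * (y - s)) 0 =
        ∫ s in (0 : ℝ)..y, (u * y + (-u) * s) := by
      apply intervalIntegral.integral_congr
      intro s hs
      rw [Set.uIcc_of_le hy] at hs
      simp only
      rw [max_eq_left (mul_nonneg hu (by linarith [hs.2]))]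
      ring
    have e4 : ∫ s in y..(x + y), max (u * (y - s)) 0 =
        ∫ s in y..(x + y), ((0 : ℝ) + 0 * s) := by
      apply intervalIntegral.integral_congr
      intro s hs
      rw [Set.uIcc_of_le (by linarith)] at hs
      simp only
      rw [max_eq_right (mul_nonpos_of_nonneg_of_nonpos hu (by linarith [hs.1]))]
      ring
    rw [e1, e2, e3, e4, integral_affine, integral_affine, integral_affine, integral_affine]
    ring
  · rintro s ⟨hs0, hs1⟩
    have k1 : 0 ≤ (A : ℝ) * (x + y - s) := mul_nonneg hA (by linarith)
    have k2 : 0 ≤ (B - w : ℝ) * (x + y - s) := mul_nonneg (by linarith) (by linarith)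
    have k3 : 0 ≤ (B - A : ℝ) * y := mul_nonneg (by linarith) hy
    have k4 : 0 ≤ (w : ℝ) * y := mul_nonneg hw hy
    simp only [max_le_iff, le_min_iff]
    rw [and_and_and_comm]
    refine ⟨⟨?_, ?_⟩, ?_, ?_⟩
    · rcases le_total s y with h | h
      · nlinarith [mul_nonneg (sub_nonneg.2 h2') (sub_nonneg.2 h), mul_nonneg hA hx,
          mul_nonneg (sub_nonneg.2 (show (A : ℝ) ≤ B by linarith)) hs0]
      · linarith [mul_nonneg hu (sub_nonneg.2 h)]
    · rcases le_total s y with h | h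
      · nlinarith [mul_nonneg (sub_nonneg.2 h2') (sub_nonneg.2 h), mul_nonneg hw hs0,
          mul_nonneg (show (0 : ℝ) ≤ B - w by linarith) hx]
      · linarith [mul_nonneg hu (sub_nonneg.2 h)]
    · linarith
    · linarith

/-- The core claim: `A x² + 2 B x y + C y²` is a volume polynomial. -/
def Realizable (A B C : ℕ) : Prop :=
  ∃ P Q : Set (ℝ × ℝ), IsLatticePolygon P ∧ IsLatticePolygon Q ∧
    ∀ x y : ℝ, 0 ≤ x → 0 ≤ y →
      nvol (x • P + y • Q) = (A : ℝ) * x ^ 2 + 2 * (B : ℝ) * x * y + (C : ℝ) * y ^ 2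

lemma Realizable.symm {A B C : ℕ} (h : Realizable A B C) : Realizable C B A := by
  obtain ⟨P, Q, hP, hQ, h⟩ := h
  refine ⟨Q, P, hQ, hP, fun x y hx hy => ?_⟩
  rw [add_comm, h y x hy hx]
  ring

lemma Realizable.shift {A B C B' C' : ℕ} (h : Realizable A B C) (hB : B' = B + A)
    (hC : C' = C + 2 * B + A) : Realizable A B' C' := by
  obtain ⟨P, Q, hP, hQ, h⟩ := h
  refine ⟨P, P + Q, hP, hP.add hQ, fun x y hx hy => ?_⟩
  rw [smul_add, ← add_assoc, ← hP.convex.add_smul hx hy, h (x + y) y (by linarith) hy, hB, hC]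
  push_cast
  ring

lemma realizable_base (A B C : ℕ) (hA : A ≤ B) (hC : C + A ≤ 2 * B) : Realizable A B C := by
  obtain ⟨u, w, h1, h2, h3⟩ : ∃ u w : ℕ, A + w ≤ B ∧ u ≤ B ∧ B + w = C + u := by
    rcases le_total C B with h | h
    · exact ⟨B - C, 0, by omega, by omega, by omega⟩
    · exact ⟨0, C - B, by omega, by omega, by omega⟩
  refine ⟨_, _, ⟨triF A, by simp [triF], rfl⟩, ⟨trapF B u w, by simp [trapF], rfl⟩,
    fun x y hx hy => ?_⟩
  rw [base_vol A B u w h1 h2 x y hx hy]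
  have : (B : ℝ) + w = C + u := by exact_mod_cast h3
  rw [this]
  ring

lemma realizable_zero (C : ℕ) : Realizable 0 0 C := by
  obtain ⟨P, Q, hP, hQ, h⟩ := realizable_base C C C le_rfl (by omega)
  refine ⟨{0}, P, ⟨{0}, by simp, by simp [toR2]; rfl⟩, hP, fun x y hx hy => ?_⟩
  have := h y 0 hy le_rfl
  rw [Set.zero_smul_set hQ.nonempty, add_zero] at this
  rw [Set.smul_set_singleton, smul_zero, Set.singleton_zero, zero_add, this]
  push_cast
  ring

lemma realizable_all (n : ℕ) : ∀ A B C : ℕ, A + B + C = n → A * C ≤ B ^ 2 →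
    Realizable A B C := by
  induction n using Nat.strong_induction_on with
  | _ n ih =>
    have key : ∀ A B C : ℕ, A + B + C = n → A * C ≤ B ^ 2 → A ≤ C → Realizable A B C := by
      intro A B C hn h hAC
      have hAB : A ≤ B := by
        by_contra! hlt
        nlinarith
      rcases Nat.eq_zero_or_pos B with rfl | hB
      · obtain rfl : A = 0 := by omega
        exact realizable_zero C
      · rcases le_total (C + A) (2 * B) with hc | hc
        · exact realizable_base A B C hAB hc
        · obtain ⟨b, rfl⟩ := Nat.exists_eq_add_of_le hAB
          obtain ⟨c, hc'⟩ := Nat.exists_eq_add_of_le hc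
          obtain rfl : C = c + 2 * b + A := by omega
          refine Realizable.shift (B := b) (C := c) (ih (A + b + c) (by omega) A b c rfl ?_)
            (by omega) rfl
          nlinarith
    intro A B C hn h
    rcases le_total A C with hAC | hAC
    · exact key A B C hn h hAC
    · exact (key C B A (by omega) (by rwa [mul_comm]) hAC).symm

/-- For every triple of non-negative integers `(A,B,C)` with
`AC ≤ B²` there exist lattice polytopes `P, Q ⊂ ℝ²` whose normalized volume
polynomial is `A x² + 2 B x y + C y²`; equivalently `Vol₂(P) = A`,
`V(P,Q) = B`, `Vol₂(Q) = C`. -/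
theorem stmt_7 (A B C : ℕ) (h : A * C ≤ B ^ 2) :
    ∃ P Q : Set (ℝ × ℝ), IsLatticePolygon P ∧ IsLatticePolygon Q ∧
      (∀ x y : ℝ, 0 ≤ x → 0 ≤ y →
        nvol (x • P + y • Q) =
          (A : ℝ) * x ^ 2 + 2 * (B : ℝ) * x * y + (C : ℝ) * y ^ 2) ∧
      nvol P = A ∧ mixedVol P Q = B ∧ nvol Q = C := by
  obtain ⟨P, Q, hP, hQ, hv⟩ := realizable_all _ A B C rfl h
  have e1 : nvol P = A := by
    have := hv 1 0 zero_le_one le_rfl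
    rw [Set.zero_smul_set hQ.nonempty, add_zero, one_smul] at this
    rw [this]
    ring
  have e2 : nvol Q = C := by
    have := hv 0 1 le_rfl zero_le_one
    rw [Set.zero_smul_set hP.nonempty, zero_add, one_smul] at this
    rw [this]
    ring
  refine ⟨P, Q, hP, hQ, hv, e1, ?_, e2⟩
  have := hv 1 1 zero_le_one zero_le_one
  rw [one_smul, one_smul] at this
  rw [mixedVol, this, e1, e2]
  ring
end

section
/- For lattice polygons P and Q in ℝ², the normalized mixed volume V(P,Q) = (Vol₂(P+Q) - Vol₂(P) - Vol₂(Q))/2 is a non-negative integer. -/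
open Pointwise MeasureTheory

/-! Upper boundary of a planar set, and the integral of the upper boundary along edges. -/

/-- The upper boundary of a planar set. -/
noncomputable def topF (K : Set (ℝ × ℝ)) (x : ℝ) : ℝ := sSup {y | (x, y) ∈ K}

/-- `i` maximizes `y + t x` over `S`. -/
def OptAt {ι : Type*} (S : Set ι) (x y : ι → ℝ) (t : ℝ) (i : ι) : Prop :=
  i ∈ S ∧ ∀ j ∈ S, y j + t * x j ≤ y i + t * x i

/-- Two elements that are optimal in a common direction. -/
def OptAdj {ι : Type*} (S : Set ι) (x y : ι → ℝ) (i j : ι) : Prop :=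
  ∃ t, OptAt S x y t i ∧ OptAt S x y t j

lemma opt_path_aux {ι : Type*} (S : Finset ι) (x y : ι → ℝ) (n : ℕ) :
    ∀ (i : ι) (t : ℝ), OptAt (S : Set ι) x y t i → (S.filter (fun j => x i < x j)).card ≤ n →
      ∃ j ∈ S, Relation.ReflTransGen (OptAdj (S : Set ι) x y) i j ∧ ∀ k ∈ S, x k ≤ x j := by
  induction n with
  | zero =>
    intro i t hi hc
    refine ⟨i, hi.1, Relation.ReflTransGen.refl, fun k hk => ?_⟩
    by_contra! h
    have : k ∈ S.filter (fun j => x i < x j) := Finset.mem_filter.2 ⟨hk, h⟩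
    have h2 := Finset.card_pos.2 ⟨k, this⟩
    omega
  | succ n ih =>
    intro i t hi hc
    by_cases hne : (S.filter (fun j => x i < x j)).Nonempty
    · obtain ⟨f, hf, hmin⟩ := Finset.exists_min_image _
        (fun f => (y i - y f) / (x f - x i)) hne
      obtain ⟨hfS, hfx⟩ := Finset.mem_filter.1 hf
      set s := (y i - y f) / (x f - x i) with hs
      have hpos : 0 < x f - x i := sub_pos.2 hfx
      have hsf : s * (x f - x i) = y i - y f := by
        rw [hs]; field_simp
      have hts : t ≤ s := by
        rw [hs, le_div_iff₀ hpos]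
        have := hi.2 f hfS
        nlinarith
      have hOi : OptAt (S : Set ι) x y s i := by
        refine ⟨hi.1, fun j hj => ?_⟩
        by_cases hx : x i < x j
        · have h1 := hmin j (Finset.mem_filter.2 ⟨hj, hx⟩)
          rw [le_div_iff₀ (sub_pos.2 hx)] at h1
          nlinarith
        · have h1 := hi.2 j hj
          push Not at hx
          nlinarith
      have hOf : OptAt (S : Set ι) x y s f := by
        refine ⟨hfS, fun j hj => ?_⟩
        have := hOi.2 j hj
        nlinarith
      have hlt : (S.filter (fun j => x f < x j)).card < (S.filter (fun j => x i < x j)).card := by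
        apply Finset.card_lt_card
        refine ⟨fun k hk => ?_, fun h => ?_⟩
        · obtain ⟨h1, h2⟩ := Finset.mem_filter.1 hk
          exact Finset.mem_filter.2 ⟨h1, hfx.trans h2⟩
        · exact lt_irrefl _ (Finset.mem_filter.1 (h hf)).2
      obtain ⟨j, hj, hr, hm⟩ := ih f s hOf (by omega)
      exact ⟨j, hj, Relation.ReflTransGen.head ⟨s, hOi, hOf⟩ hr, hm⟩
    · apply ih i t hi
      rw [Finset.not_nonempty_iff_eq_empty.1 hne]
      simp

lemma opt_path {ι : Type*} (S : Finset ι) (hS : S.Nonempty) (x y : ι → ℝ) :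
    ∃ i ∈ S, ∃ j ∈ S, Relation.ReflTransGen (OptAdj (S : Set ι) x y) i j ∧
      (∀ k ∈ S, x i ≤ x k) ∧ ∀ k ∈ S, x k ≤ x j := by
  obtain ⟨i₀, hi₀, hmin⟩ := Finset.exists_min_image S x hS
  obtain ⟨i, hi, hmax⟩ := Finset.exists_max_image (S.filter (fun k => x k = x i₀)) y
    ⟨i₀, Finset.mem_filter.2 ⟨hi₀, rfl⟩⟩
  obtain ⟨hiS, hix⟩ := Finset.mem_filter.1 hi
  obtain ⟨t, ht⟩ := (S.image (fun f => (y i - y f) / (x f - x i))).bddBelow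
  have hO : OptAt (S : Set ι) x y t i := by
    refine ⟨hiS, fun j hj => ?_⟩
    rcases (hmin j hj).eq_or_lt with h | h
    · have := hmax j (Finset.mem_filter.2 ⟨hj, h.symm⟩)
      rw [hix, ← h]; linarith
    · rw [← hix] at h
      have h1 : t ≤ (y i - y j) / (x j - x i) :=
        ht (by simpa using ⟨j, hj, rfl⟩)
      rw [le_div_iff₀ (sub_pos.2 h)] at h1
      nlinarith
  obtain ⟨j, hj, hr, hm⟩ := opt_path_aux S x y _ i t hO le_rfl
  exact ⟨i, hiS, j, hj, hr, fun k hk => hix ▸ hmin k hk, hm⟩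

lemma topF_segment {K : Set (ℝ × ℝ)} (hK : Convex ℝ K) {t : ℝ} {u v : ℝ × ℝ}
    (hu : OptAt K Prod.fst Prod.snd t u) (hv : OptAt K Prod.fst Prod.snd t v) {x : ℝ}
    (hx : x ∈ Set.uIcc u.1 v.1) : topF K x = u.2 + t * (u.1 - x) := by
  have huv : u.2 + t * u.1 = v.2 + t * v.1 := le_antisymm (hv.2 u hu.1) (hu.2 v hv.1)
  have : IsGreatest {y | (x, y) ∈ K} (u.2 + t * (u.1 - x)) := by
    constructor
    · rw [← segment_eq_uIcc] at hx
      obtain ⟨a, b, ha, hb, hab, rfl⟩ := hx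
      have := hK hu.1 hv.1 ha hb hab
      show (_, _) ∈ K
      convert this using 1
      ext
      · simp
      · simp
        have hv2 : v.2 = u.2 + t * u.1 - t * v.1 := by linarith
        have hb2 : b = 1 - a := by linarith
        rw [hv2, hb2]; ring
    · intro y hy
      have := hu.2 _ hy
      simp at this
      linarith
  exact this.csSup_eq

lemma topF_integral {K : Set (ℝ × ℝ)} (hK : Convex ℝ K) {t : ℝ} {u v : ℝ × ℝ}
    (hu : OptAt K Prod.fst Prod.snd t u) (hv : OptAt K Prod.fst Prod.snd t v) :
    IntervalIntegrable (topF K) volume u.1 v.1 ∧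
      ∫ x in u.1..v.1, topF K x = (v.1 - u.1) * (u.2 + v.2) / 2 := by
  have huv : u.2 + t * u.1 = v.2 + t * v.1 := le_antisymm (hv.2 u hu.1) (hu.2 v hv.1)
  have hc : Continuous (fun x : ℝ => u.2 + t * (u.1 - x)) := by fun_prop
  have heq : Set.EqOn (fun x : ℝ => u.2 + t * (u.1 - x)) (topF K) (Set.uIcc u.1 v.1) :=
    fun x hx => (topF_segment hK hu hv hx).symm
  constructor
  · exact (hc.intervalIntegrable _ _).congr (heq.mono Set.uIoc_subset_uIcc)
  · rw [← intervalIntegral.integral_congr heq]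
    have hd : ∀ x ∈ Set.uIcc u.1 v.1, HasDerivAt
        (fun x : ℝ => (u.2 + t * u.1) * x - t * (x ^ 2 / 2)) (u.2 + t * (u.1 - x)) x := by
      intro x _
      have h1 := ((hasDerivAt_id x).const_mul (u.2 + t * u.1)).sub
        ((((hasDerivAt_id x).pow 2).div_const 2).const_mul t)
      refine h1.congr_deriv ?_
      simp only [id, mul_one, Nat.cast_ofNat]; ring
    rw [intervalIntegral.integral_eq_sub_of_hasDerivAt hd (hc.intervalIntegrable _ _)]
    have hv2 : v.2 = u.2 + t * u.1 - t * v.1 := by linarith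
    rw [hv2]; ring

lemma optAt_hull {F : Finset (ℤ × ℤ)} {t : ℝ} {p : ℤ × ℤ}
    (hp : p ∈ F) (h : ∀ q ∈ F, (q.2 : ℝ) + t * q.1 ≤ p.2 + t * p.1) :
    OptAt (convexHull ℝ (toR2 '' (F : Set (ℤ × ℤ)))) Prod.fst Prod.snd t (toR2 p) := by
  refine ⟨subset_convexHull _ _ ⟨p, hp, rfl⟩, fun q hq => ?_⟩
  have hconv : Convex ℝ {w : ℝ × ℝ | w.2 + t * w.1 ≤ (p.2 : ℝ) + t * p.1} := by
    apply convex_halfSpace_le (f := fun w : ℝ × ℝ => w.2 + t * w.1)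
    constructor
    · intro a b; simp; ring
    · intro a b; simp; ring
  have hsub : toR2 '' (F : Set (ℤ × ℤ)) ⊆ {w : ℝ × ℝ | w.2 + t * w.1 ≤ (p.2 : ℝ) + t * p.1} := by
    rintro _ ⟨r, hr, rfl⟩
    exact h r hr
  exact convexHull_min hsub hconv hq

lemma optAt_add {K L : Set (ℝ × ℝ)} {t : ℝ} {u v : ℝ × ℝ}
    (hu : OptAt K Prod.fst Prod.snd t u) (hv : OptAt L Prod.fst Prod.snd t v) :
    OptAt (K + L) Prod.fst Prod.snd t (u + v) := by
  refine ⟨Set.add_mem_add hu.1 hv.1, ?_⟩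
  rintro _ ⟨a, ha, b, hb, rfl⟩
  have h1 := hu.2 a ha
  have h2 := hv.2 b hb
  simp only [Prod.fst_add, Prod.snd_add]
  linarith

/-- The convex hull of a set of lattice points. -/
def hullZ (F : Finset (ℤ × ℤ)) : Set (ℝ × ℝ) := convexHull ℝ (toR2 '' (F : Set (ℤ × ℤ)))

/-- The statement propagated along a path of vertices. -/
def StepProp (F G : Finset (ℤ × ℤ)) (a a' c c' : ℤ) : Prop :=
  IntervalIntegrable (topF (hullZ F)) volume a a' ∧
  IntervalIntegrable (topF (hullZ G)) volume c c' ∧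
  IntervalIntegrable (topF (hullZ F + hullZ G)) volume ((a : ℝ) + c) (a' + c') ∧
  ∃ z : ℤ, (∫ x in ((a : ℝ) + c)..(a' + c'), topF (hullZ F + hullZ G) x)
    - (∫ x in (a : ℝ)..a', topF (hullZ F) x) - (∫ x in (c : ℝ)..c', topF (hullZ G) x) = z

lemma stepProp_trans {F G : Finset (ℤ × ℤ)} {a a' a'' c c' c'' : ℤ}
    (h1 : StepProp F G a a' c c') (h2 : StepProp F G a' a'' c' c'') :
    StepProp F G a a'' c c'' := by
  obtain ⟨p1, q1, r1, z1, e1⟩ := h1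
  obtain ⟨p2, q2, r2, z2, e2⟩ := h2
  refine ⟨p1.trans p2, q1.trans q2, r1.trans r2, z1 + z2, ?_⟩
  rw [← intervalIntegral.integral_add_adjacent_intervals p1 p2,
    ← intervalIntegral.integral_add_adjacent_intervals q1 q2,
    ← intervalIntegral.integral_add_adjacent_intervals r1 r2]
  push_cast
  linarith

lemma stepProp_step {F G : Finset (ℤ × ℤ)} {t : ℝ} {p p' q q' : ℤ × ℤ}
    (hp : OptAt (hullZ F) Prod.fst Prod.snd t (toR2 p))
    (hp' : OptAt (hullZ F) Prod.fst Prod.snd t (toR2 p'))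
    (hq : OptAt (hullZ G) Prod.fst Prod.snd t (toR2 q))
    (hq' : OptAt (hullZ G) Prod.fst Prod.snd t (toR2 q')) :
    StepProp F G p.1 p'.1 q.1 q'.1 := by
  have cF : Convex ℝ (hullZ F) := convex_convexHull _ _
  have cG : Convex ℝ (hullZ G) := convex_convexHull _ _
  obtain ⟨i1, e1⟩ := topF_integral cF hp hp'
  obtain ⟨i2, e2⟩ := topF_integral cG hq hq'
  obtain ⟨i3, e3⟩ := topF_integral (cF.add cG) (optAt_add hp hq) (optAt_add hp' hq')
  have hP := le_antisymm (hp.2 _ hp'.1) (hp'.2 _ hp.1)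
  have hQ := le_antisymm (hq.2 _ hq'.1) (hq'.2 _ hq.1)
  simp only [toR2, Prod.fst_add, Prod.snd_add] at i1 i2 i3 e1 e2 e3 hP hQ
  refine ⟨i1, i2, i3, q.2 * (p'.1 - p.1) + p.2 * (q'.1 - q.1) + (p'.1 - p.1) * (q'.2 - q.2), ?_⟩
  rw [e1, e2, e3]
  push_cast
  have hb : (p'.2 : ℝ) = p.2 + t * p.1 - t * p'.1 := by linarith
  have hd : (q'.2 : ℝ) = q.2 + t * q.1 - t * q'.1 := by linarith
  rw [hb, hd]; ring

/-- The upper boundary integral is additive modulo integers. -/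
lemma upper_main (F G : Finset (ℤ × ℤ)) (hF : F.Nonempty) (hG : G.Nonempty) (a a' c c' : ℤ)
    (ha : IsLeast (Prod.fst '' (F : Set (ℤ × ℤ))) a)
    (ha' : IsGreatest (Prod.fst '' (F : Set (ℤ × ℤ))) a')
    (hc : IsLeast (Prod.fst '' (G : Set (ℤ × ℤ))) c)
    (hc' : IsGreatest (Prod.fst '' (G : Set (ℤ × ℤ))) c') :
    StepProp F G a a' c c' := by
  obtain ⟨i, hi, j, hj, hr, hmin, hmax⟩ := opt_path (F ×ˢ G) (hF.product hG)
    (fun r => (r.1.1 : ℝ) + r.2.1) (fun r => (r.1.2 : ℝ) + r.2.2)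
  have key : ∀ k, Relation.ReflTransGen (OptAdj ((F ×ˢ G : Finset _) : Set _)
      (fun r => (r.1.1 : ℝ) + r.2.1) (fun r => (r.1.2 : ℝ) + r.2.2)) i k →
      StepProp F G i.1.1 k.1.1 i.2.1 k.2.1 := by
    intro k hk
    induction hk with
    | refl =>
      refine ⟨by simp, by simp, by simp, 0, by simp⟩
    | tail _ hs ih =>
      refine stepProp_trans ih ?_
      obtain ⟨t, h1, h2⟩ := hs
      have hcvt : ∀ r : (ℤ × ℤ) × (ℤ × ℤ), OptAt ((F ×ˢ G : Finset _) : Set _)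
          (fun r : (ℤ × ℤ) × (ℤ × ℤ) => (r.1.1 : ℝ) + r.2.1)
          (fun r => (r.1.2 : ℝ) + r.2.2) t r →
          OptAt (hullZ F) Prod.fst Prod.snd t (toR2 r.1) ∧
          OptAt (hullZ G) Prod.fst Prod.snd t (toR2 r.2) := by
        rintro ⟨f, g⟩ ⟨hm, ho⟩
        obtain ⟨hf, hg⟩ := Finset.mem_product.1 (Finset.mem_coe.1 hm)
        constructor
        · refine optAt_hull hf fun q hq => ?_
          have := ho (q, g) (Finset.mem_coe.2 (Finset.mem_product.2 ⟨hq, hg⟩))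
          simp only at this
          linarith
        · refine optAt_hull hg fun q hq => ?_
          have := ho (f, q) (Finset.mem_coe.2 (Finset.mem_product.2 ⟨hf, hq⟩))
          simp only at this
          linarith
      exact stepProp_step (hcvt _ h1).1 (hcvt _ h2).1 (hcvt _ h1).2 (hcvt _ h2).2
  have hfin := key j hr
  obtain ⟨hi1, hi2⟩ := Finset.mem_product.1 hi
  obtain ⟨hj1, hj2⟩ := Finset.mem_product.1 hj
  have e1 : i.1.1 = a := by
    obtain ⟨f, hf, hfa⟩ := ha.1
    have h := hmin (f, i.2) (Finset.mem_product.2 ⟨hf, hi2⟩)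
    have h' : (i.1.1 : ℝ) ≤ f.1 := by simpa using h
    have h3 : i.1.1 ≤ f.1 := by exact_mod_cast h'
    exact le_antisymm (hfa ▸ h3) (ha.2 ⟨i.1, hi1, rfl⟩)
  have e2 : i.2.1 = c := by
    obtain ⟨f, hf, hfa⟩ := hc.1
    have h := hmin (i.1, f) (Finset.mem_product.2 ⟨hi1, hf⟩)
    have h' : (i.2.1 : ℝ) ≤ f.1 := by simpa using h
    have h3 : i.2.1 ≤ f.1 := by exact_mod_cast h'
    exact le_antisymm (hfa ▸ h3) (hc.2 ⟨i.2, hi2, rfl⟩)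
  have e3 : j.1.1 = a' := by
    obtain ⟨f, hf, hfa⟩ := ha'.1
    have h := hmax (f, j.2) (Finset.mem_product.2 ⟨hf, hj2⟩)
    have h' : (f.1 : ℝ) ≤ j.1.1 := by simpa using h
    have h3 : f.1 ≤ j.1.1 := by exact_mod_cast h'
    exact le_antisymm (ha'.2 ⟨j.1, hj1, rfl⟩) (hfa ▸ h3)
  have e4 : j.2.1 = c' := by
    obtain ⟨f, hf, hfa⟩ := hc'.1
    have h := hmax (j.1, f) (Finset.mem_product.2 ⟨hj1, hf⟩)
    have h' : (f.1 : ℝ) ≤ j.2.1 := by simpa using h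
    have h3 : f.1 ≤ j.2.1 := by exact_mod_cast h'
    exact le_antisymm (hc'.2 ⟨j.2, hj2, rfl⟩) (hfa ▸ h3)
  rw [e1, e2, e3, e4] at hfin
  exact hfin

/-- Reflection in the horizontal axis. -/
def reflY : (ℝ × ℝ) →ₗ[ℝ] (ℝ × ℝ) :=
  (LinearMap.fst ℝ ℝ ℝ).prod (-(LinearMap.snd ℝ ℝ ℝ))

lemma reflY_apply (p : ℝ × ℝ) : reflY p = (p.1, -p.2) := rfl

lemma topF_reflY (K : Set (ℝ × ℝ)) (x : ℝ) :
    topF (reflY '' K) x = - sInf {y | (x, y) ∈ K} := by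
  have : {y | (x, y) ∈ reflY '' K} = - {y | (x, y) ∈ K} := by
    ext y
    simp only [Set.mem_ofPred_eq, Set.mem_image, Set.mem_neg, reflY_apply]
    constructor
    · rintro ⟨⟨p, q⟩, hp, h⟩
      simp only [Prod.mk.injEq] at h
      obtain ⟨rfl, rfl⟩ := h
      simpa using hp
    · intro h
      exact ⟨_, h, by simp⟩
  rw [topF, this, Real.sInf_def, neg_neg]

lemma area_formula {K : Set (ℝ × ℝ)} (hc : IsCompact K) (hK : Convex ℝ K) {m M : ℝ} (hmM : m ≤ M)
    (hfst : Prod.fst '' K = Set.Icc m M)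
    (h1 : IntervalIntegrable (topF K) volume m M)
    (h2 : IntervalIntegrable (topF (reflY '' K)) volume m M) :
    (volume K).toReal = (∫ x in m..M, topF K x) + ∫ x in m..M, topF (reflY '' K) x := by
  have hslice : ∀ x ∈ Set.Icc m M, volume {y | (x, y) ∈ K} =
      ENNReal.ofReal (topF K x + topF (reflY '' K) x) ∧ 0 ≤ topF K x + topF (reflY '' K) x := by
    intro x hx
    have hcs : IsCompact {y | (x, y) ∈ K} := by
      have he : {y | (x, y) ∈ K} = Prod.snd '' (K ∩ {p | p.1 = x}) := by
        ext y
        constructor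
        · intro h
          exact ⟨(x, y), ⟨h, rfl⟩, rfl⟩
        · rintro ⟨⟨p, q⟩, ⟨h, rfl⟩, rfl⟩
          exact h
      rw [he]
      exact (hc.inter_right (isClosed_eq continuous_fst continuous_const)).image continuous_snd
    have hcv : Convex ℝ {y | (x, y) ∈ K} := by
      intro y hy z hz a b ha hb hab
      have := hK hy hz ha hb hab
      have e : a • (x, y) + b • (x, z) = (x, a • y + b • z) := by
        ext
        · simp [← add_mul, hab]
        · simp
      rw [e] at this
      exact this
    have hne : {y | (x, y) ∈ K}.Nonempty := by
      rw [← hfst] at hx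
      obtain ⟨⟨p, q⟩, h, rfl⟩ := hx
      exact ⟨q, h⟩
    have hI := eq_Icc_of_connected_compact ⟨hne, hcv.isPreconnected⟩ hcs
    rw [topF_reflY, topF]
    constructor
    · conv_lhs => rw [hI]
      rw [Real.volume_Icc, sub_eq_add_neg]
    · have := csInf_le_csSup hne hcs.bddBelow hcs.bddAbove
      linarith
  have hvol : volume K = ∫⁻ x in Set.Icc m M,
      ENNReal.ofReal (topF K x + topF (reflY '' K) x) := by
    rw [Measure.volume_eq_prod, Measure.prod_apply hc.measurableSet,
      ← lintegral_indicator measurableSet_Icc]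
    refine lintegral_congr fun x => ?_
    by_cases hx : x ∈ Set.Icc m M
    · rw [Set.indicator_of_mem hx]
      exact (hslice x hx).1
    · rw [Set.indicator_of_notMem hx]
      have : Prod.mk x ⁻¹' K = ∅ := by
        ext y
        simp only [Set.mem_preimage, Set.mem_empty_iff_false, iff_false]
        intro h
        apply hx
        rw [← hfst]
        exact ⟨_, h, rfl⟩
      rw [this, measure_empty]
  have hintg := h1.add h2
  rw [intervalIntegrable_iff_integrableOn_Icc_of_le hmM] at hintg
  rw [hvol, ← intervalIntegral.integral_add h1 h2, intervalIntegral.integral_of_le hmM,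
    ← integral_Icc_eq_integral_Ioc, ← ofReal_integral_eq_lintegral_ofReal hintg,
    ENNReal.toReal_ofReal]
  · exact setIntegral_nonneg measurableSet_Icc fun x hx => (hslice x hx).2
  · exact (ae_restrict_iff' measurableSet_Icc).2 (Filter.Eventually.of_forall
      fun x hx => (hslice x hx).2)

lemma hullZ_compact (F : Finset (ℤ × ℤ)) : IsCompact (hullZ F) :=
  (F.finite_toSet.image toR2).isCompact_convexHull ℝ

lemma hullZ_fst {F : Finset (ℤ × ℤ)} {a a' : ℤ}
    (ha : IsLeast (Prod.fst '' (F : Set (ℤ × ℤ))) a)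
    (ha' : IsGreatest (Prod.fst '' (F : Set (ℤ × ℤ))) a') :
    Prod.fst '' hullZ F = Set.Icc (a : ℝ) a' := by
  have h := (LinearMap.fst ℝ ℝ ℝ).image_convexHull (toR2 '' (F : Set (ℤ × ℤ)))
  simp only [LinearMap.coe_fst] at h
  rw [hullZ, h]
  obtain ⟨p, hp, hpa⟩ := ha.1
  obtain ⟨q, hq, hqa⟩ := ha'.1
  apply Set.Subset.antisymm
  · apply convexHull_min _ (convex_Icc _ _)
    rintro _ ⟨_, ⟨r, hr, rfl⟩, rfl⟩
    have h1 := ha.2 ⟨r, hr, rfl⟩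
    have h2 := ha'.2 ⟨r, hr, rfl⟩
    exact ⟨by simpa [toR2] using h1, by simpa [toR2] using h2⟩
  · have hle : (a : ℝ) ≤ a' := by exact_mod_cast ha.2 ha'.1
    rw [← segment_eq_Icc hle]
    apply segment_subset_convexHull
    · exact ⟨_, ⟨p, hp, rfl⟩, by simp [toR2, ← hpa]⟩
    · exact ⟨_, ⟨q, hq, rfl⟩, by simp [toR2, ← hqa]⟩

/-- Reflection of a set of lattice points. -/
def reflZ (F : Finset (ℤ × ℤ)) : Finset (ℤ × ℤ) := F.image (fun p => (p.1, -p.2))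

lemma hullZ_refl (F : Finset (ℤ × ℤ)) : reflY '' hullZ F = hullZ (reflZ F) := by
  rw [hullZ, LinearMap.image_convexHull, hullZ, reflZ, Finset.coe_image, Set.image_image,
    Set.image_image]
  congr 1
  apply Set.image_congr
  intro p _
  simp [reflY_apply, toR2]

lemma reflZ_fst (F : Finset (ℤ × ℤ)) :
    Prod.fst '' (reflZ F : Set (ℤ × ℤ)) = Prod.fst '' (F : Set (ℤ × ℤ)) := by
  rw [reflZ, Finset.coe_image, Set.image_image]

lemma exists_range {F : Finset (ℤ × ℤ)} (hF : F.Nonempty) :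
    ∃ a a' : ℤ, IsLeast (Prod.fst '' (F : Set (ℤ × ℤ))) a ∧
      IsGreatest (Prod.fst '' (F : Set (ℤ × ℤ))) a' := by
  obtain ⟨p, hp, h⟩ := Finset.exists_min_image F Prod.fst hF
  obtain ⟨q, hq, h'⟩ := Finset.exists_max_image F Prod.fst hF
  refine ⟨p.1, q.1, ⟨⟨p, hp, rfl⟩, ?_⟩, ⟨⟨q, hq, rfl⟩, ?_⟩⟩
  · rintro _ ⟨r, hr, rfl⟩
    exact h r hr
  · rintro _ ⟨r, hr, rfl⟩
    exact h' r hr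

lemma mixed_int (F G : Finset (ℤ × ℤ)) (hF : F.Nonempty) (hG : G.Nonempty) :
    ∃ z : ℤ, (volume (hullZ F + hullZ G)).toReal - (volume (hullZ F)).toReal
      - (volume (hullZ G)).toReal = z := by
  obtain ⟨a, a', ha, ha'⟩ := exists_range hF
  obtain ⟨c, c', hc, hc'⟩ := exists_range hG
  obtain ⟨i1, i2, i3, z, e⟩ := upper_main F G hF hG a a' c c' ha ha' hc hc'
  obtain ⟨j1, j2, j3, w, e'⟩ := upper_main (reflZ F) (reflZ G) (hF.image _) (hG.image _) a a' c c'
    (by rwa [reflZ_fst]) (by rwa [reflZ_fst]) (by rwa [reflZ_fst]) (by rwa [reflZ_fst])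
  rw [← hullZ_refl, ← hullZ_refl, ← Set.image_add] at j3 e'
  rw [← hullZ_refl] at j1 j2
  have cF : Convex ℝ (hullZ F) := convex_convexHull _ _
  have cG : Convex ℝ (hullZ G) := convex_convexHull _ _
  have l1 : (a : ℝ) ≤ a' := by exact_mod_cast ha.2 ha'.1
  have l2 : (c : ℝ) ≤ c' := by exact_mod_cast hc.2 hc'.1
  have f3 : Prod.fst '' (hullZ F + hullZ G) = Set.Icc ((a : ℝ) + c) (a' + c') := by
    have := Set.image_add (LinearMap.fst ℝ ℝ ℝ) (s := hullZ F) (t := hullZ G)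
    simp only [LinearMap.coe_fst] at this
    rw [this, hullZ_fst ha ha', hullZ_fst hc hc', Set.Icc_add_Icc l1 l2]
  have A1 := area_formula (hullZ_compact F) cF l1 (hullZ_fst ha ha') i1 j1
  have A2 := area_formula (hullZ_compact G) cG l2 (hullZ_fst hc hc') i2 j2
  have A3 := area_formula ((hullZ_compact F).add (hullZ_compact G)) (cF.add cG)
    (add_le_add l1 l2) f3 i3 j3
  refine ⟨z + w, ?_⟩
  rw [A1, A2, A3]
  push_cast
  linarith

lemma mixed_nonneg {K L : Set (ℝ × ℝ)} (hK : IsCompact K) (hL : IsCompact L)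
    (nK : K.Nonempty) (nL : L.Nonempty) :
    (volume K).toReal + (volume L).toReal ≤ (volume (K + L)).toReal := by
  obtain ⟨p, hp, hpm⟩ := hK.exists_isMaxOn nK continuous_fst.continuousOn
  obtain ⟨q, hq, hqm⟩ := hL.exists_isMinOn nL continuous_fst.continuousOn
  have hsub : (q +ᵥ K) ∪ (p +ᵥ L) ⊆ K + L := by
    rintro _ (⟨k, hk, rfl⟩ | ⟨l, hl, rfl⟩)
    · exact ⟨k, hk, q, hq, add_comm _ _⟩
    · exact ⟨p, hp, l, hl, rfl⟩
  have hdis : AEDisjoint volume (q +ᵥ K) (p +ᵥ L) := by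
    have hline : volume {r : ℝ × ℝ | r.1 = p.1 + q.1} = 0 := by
      have : {r : ℝ × ℝ | r.1 = p.1 + q.1} = {p.1 + q.1} ×ˢ Set.univ := by
        ext r; simp
      rw [this, Measure.volume_eq_prod, Measure.prod_prod]
      simp
    refine measure_mono_null ?_ hline
    rintro r ⟨⟨k, hk, rfl⟩, ⟨l, hl, h⟩⟩
    have h1 : k.1 ≤ p.1 := hpm hk
    have h2 : q.1 ≤ l.1 := hqm hl
    have h3 : p.1 + l.1 = q.1 + k.1 := congrArg Prod.fst h
    show q.1 + k.1 = p.1 + q.1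
    linarith
  have hmeas : MeasurableSet (p +ᵥ L) := (hL.vadd p).measurableSet
  have hle := measure_mono (μ := volume) hsub
  rw [measure_union₀ hmeas.nullMeasurableSet hdis, measure_vadd, measure_vadd] at hle
  rw [← ENNReal.toReal_add hK.measure_lt_top.ne hL.measure_lt_top.ne]
  exact ENNReal.toReal_mono (hK.add hL).measure_lt_top.ne hle

/-- For lattice polygons `P` and `Q` in `ℝ²` the normalized mixed
volume `V(P,Q)` is a non-negative integer. -/
theorem stmt_8 (P Q : Set (ℝ × ℝ)) (hP : IsLatticePolygon P)
    (hQ : IsLatticePolygon Q) : ∃ n : ℕ, mixedVol P Q = n := by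
  obtain ⟨F, hF, rfl⟩ := hP
  obtain ⟨G, hG, rfl⟩ := hQ
  obtain ⟨z, hz⟩ := mixed_int F G hF hG
  have hne : ∀ H : Finset (ℤ × ℤ), H.Nonempty → (hullZ H).Nonempty := fun H hH =>
    ((Finset.coe_nonempty.2 hH).image toR2).convexHull
  have hn := mixed_nonneg (hullZ_compact F) (hullZ_compact G) (hne F hF) (hne G hG)
  have hz0 : (0 : ℝ) ≤ z := by rw [← hz]; linarith
  have hz1 : 0 ≤ z := by exact_mod_cast hz0
  obtain ⟨n, rfl⟩ := Int.eq_ofNat_of_zero_le hz1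
  refine ⟨n, ?_⟩
  simp only [mixedVol, nvol]
  simp only [hullZ] at hz
  push_cast at hz
  linarith
end

section
/- Let d, e ≥ 0 and b be integers with d + b - e ≥ 0, let x₁ ≥ y₁ ≥ 0 and x₂ ≥ y₂ ≥ 0 be integers, and for i = 1,2 let Pᵢ = conv{(0,yᵢ), (0,xᵢ), (eyᵢ,0), (dxᵢ+byᵢ,0), (dxᵢ+byᵢ, xᵢ-yᵢ), (dxᵢ+(b-e)yᵢ, xᵢ)}. Then the normalized mixed volume satisfies V(P₁,P₂) = (2d)x₁x₂ + b(x₁y₂ + x₂y₁) - (2e)y₁y₂. -/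
open Pointwise MeasureTheory

/-- The hexagon by inequalities: `w` the width, `x` the height, `y` the height of the cut
corners, `e` the inverse slope of the cut. -/
def hexa (e w x y : ℝ) : Set (ℝ × ℝ) :=
  {p | 0 ≤ p.1 ∧ p.1 ≤ w ∧ 0 ≤ p.2 ∧ p.2 ≤ x ∧ e * y ≤ p.1 + e * p.2 ∧
    p.1 + e * p.2 ≤ w + e * (x - y)}

/-- The vertices. -/
def verts (e w x y : ℝ) : Set (ℝ × ℝ) :=
  {(0, y), (0, x), (e * y, 0), (w, 0), (w, x - y), (w - e * y, x)}

theorem seg_mem {S : Set (ℝ × ℝ)} (hS : Convex ℝ S) (c k c' k' u v t : ℝ)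
    (hu : (c - k * u, c' - k' * u) ∈ S) (hv : (c - k * v, c' - k' * v) ∈ S)
    (h1 : u ≤ t) (h2 : t ≤ v) : (c - k * t, c' - k' * t) ∈ S := by
  have hc : Convex ℝ {s : ℝ | (c - k * s, c' - k' * s) ∈ S} := by
    intro s hs r hr a b' ha hb hab
    have := hS hs hr ha hb hab
    simp only [Set.mem_ofPred_eq]
    convert this using 1
    ext
    · simp only [Prod.smul_mk, Prod.mk_add_mk, smul_eq_mul]
      linear_combination (-c) * hab
    · simp only [Prod.smul_mk, Prod.mk_add_mk, smul_eq_mul]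
      linear_combination (-c') * hab
  exact hc.ordConnected.out hu hv ⟨h1, h2⟩

theorem hexa_convex (e w x y : ℝ) : Convex ℝ (hexa e w x y) := by
  rintro ⟨p1, p2⟩ ⟨a1, a2, a3, a4, a5, a6⟩ ⟨q1, q2⟩ ⟨b1, b2, b3, b4, b5, b6⟩ s t hs ht hst
  obtain rfl : t = 1 - s := by linarith
  simp only [hexa, Set.mem_ofPred_eq, Prod.smul_mk, Prod.mk_add_mk, smul_eq_mul] at *
  refine ⟨?_, ?_, ?_, ?_, ?_, ?_⟩ <;> nlinarith

theorem hull_eq (e w x y : ℝ) (he : 0 ≤ e) (hy : 0 ≤ y) (hxy : y ≤ x) (hw : e * y ≤ w) :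
    convexHull ℝ (verts e w x y) = hexa e w x y := by
  have hey : 0 ≤ e * y := mul_nonneg he hy
  have hexy : 0 ≤ e * (x - y) := mul_nonneg he (by linarith)
  apply Set.Subset.antisymm
  · apply convexHull_min _ (hexa_convex e w x y)
    rintro p (rfl | rfl | rfl | rfl | rfl | rfl) <;>
    · simp only [hexa, Set.mem_ofPred_eq]
      refine ⟨?_, ?_, ?_, ?_, ?_, ?_⟩ <;> nlinarith
  · rintro ⟨X, Y⟩ ⟨h1, h2, h3, h4, h5, h6⟩
    simp only at h1 h2 h3 h4 h5 h6
    have hC := convex_convexHull ℝ (verts e w x y)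
    have hsub := subset_convexHull ℝ (verts e w x y)
    have m1 : (0, y) ∈ convexHull ℝ (verts e w x y) := hsub (by simp [verts])
    have m2 : (0, x) ∈ convexHull ℝ (verts e w x y) := hsub (by simp [verts])
    have m3 : (e * y, 0) ∈ convexHull ℝ (verts e w x y) := hsub (by simp [verts])
    have m4 : (w, 0) ∈ convexHull ℝ (verts e w x y) := hsub (by simp [verts])
    have m5 : (w, x - y) ∈ convexHull ℝ (verts e w x y) := hsub (by simp [verts])
    have m6 : (w - e * y, x) ∈ convexHull ℝ (verts e w x y) := hsub (by simp [verts])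
    have hl : ∃ l, l ≤ X ∧ (l, Y) ∈ convexHull ℝ (verts e w x y) := by
      rcases le_total Y y with h | h
      · refine ⟨e * y - e * Y, by linarith, ?_⟩
        have := seg_mem hC (e * y) e 0 (-1) 0 y Y (by simpa using m3) (by simpa using m1) h3 h
        simpa using this
      · refine ⟨0, h1, ?_⟩
        have := seg_mem hC 0 0 0 (-1) y x Y (by simpa using m1) (by simpa using m2) h h4
        simpa using this
    have hr : ∃ r, X ≤ r ∧ (r, Y) ∈ convexHull ℝ (verts e w x y) := by
      rcases le_total Y (x - y) with h | h
      · refine ⟨w, h2, ?_⟩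
        have := seg_mem hC w 0 0 (-1) 0 (x - y) Y (by simpa using m4) (by simpa using m5) h3 h
        simpa using this
      · refine ⟨w + e * (x - y) - e * Y, by linarith, ?_⟩
        have := seg_mem hC (w + e * (x - y)) e 0 (-1) (x - y) x Y (by simpa using m5)
          (by convert m6 using 2 <;> ring) h h4
        simpa using this
    obtain ⟨l, hl, hl'⟩ := hl
    obtain ⟨r, hr, hr'⟩ := hr
    have := seg_mem hC 0 (-1) Y 0 l r X (by simpa using hl') (by simpa using hr') hl hr
    simpa using this

theorem hexa_vol (e w x y : ℝ) (he : 0 ≤ e) (hy : 0 ≤ y) (hxy : y ≤ x) (hw : e * y ≤ w) :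
    (volume (hexa e w x y)).toReal = w * x - e * y ^ 2 := by
  have hey : 0 ≤ e * y := mul_nonneg he hy
  have hexy : 0 ≤ e * (x - y) := mul_nonneg he (by linarith)
  have hmeas : MeasurableSet (hexa e w x y) := by
    apply IsClosed.measurableSet
    have : hexa e w x y = {p | 0 ≤ p.1} ∩ {p | p.1 ≤ w} ∩ {p | 0 ≤ p.2} ∩ {p | p.2 ≤ x} ∩
        {p | e * y ≤ p.1 + e * p.2} ∩ {p | p.1 + e * p.2 ≤ w + e * (x - y)} := by
      ext p; simp [hexa, and_assoc]
    rw [this]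
    refine ((((IsClosed.inter ?_ ?_).inter ?_).inter ?_).inter ?_).inter ?_ <;>
      exact isClosed_le (by fun_prop) (by fun_prop)
  let f : ℝ → ℝ := fun Y => w - max 0 (e * (Y - (x - y))) - max 0 (e * (y - Y))
  have hf0 : ∀ Y ∈ Set.Icc 0 x, 0 ≤ f Y := by
    rintro Y ⟨hY0, hYx⟩
    have q1 : 0 ≤ e * Y := mul_nonneg he hY0
    have q2 : 0 ≤ e * (x - Y) := mul_nonneg he (by linarith)
    simp only [f]
    rcases max_cases 0 (e * (Y - (x - y))) with ⟨a, _⟩ | ⟨a, _⟩ <;>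
    rcases max_cases 0 (e * (y - Y)) with ⟨b, _⟩ | ⟨b, _⟩ <;> rw [a, b] <;> nlinarith
  have hfib : ∀ Y, volume ((fun X => (X, Y)) ⁻¹' hexa e w x y) =
      (Set.Icc 0 x).indicator (fun Y => ENNReal.ofReal (f Y)) Y := by
    intro Y
    by_cases hY : Y ∈ Set.Icc 0 x
    · rw [Set.indicator_of_mem hY]
      have : (fun X => (X, Y)) ⁻¹' hexa e w x y =
          Set.Icc (max 0 (e * (y - Y))) (w - max 0 (e * (Y - (x - y)))) := by
        ext X
        have hmm : X ≤ w - max 0 (e * (Y - (x - y))) ↔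
            max 0 (e * (Y - (x - y))) ≤ w - X := by constructor <;> intro h <;> linarith
        simp only [hexa, Set.mem_preimage, Set.mem_ofPred_eq, Set.mem_Icc, hmm, max_le_iff]
        obtain ⟨hY0, hYx⟩ := hY
        constructor
        · rintro ⟨a1, a2, a3, a4, a5, a6⟩
          refine ⟨⟨?_, ?_⟩, ?_, ?_⟩ <;> linarith
        · rintro ⟨⟨a1, a2⟩, a3, a4⟩
          refine ⟨?_, ?_, ?_, ?_, ?_, ?_⟩ <;> linarith
      rw [this, Real.volume_Icc]
    · rw [Set.indicator_of_notMem hY]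
      convert measure_empty (μ := (volume : Measure ℝ))
      ext X
      simp only [hexa, Set.mem_preimage, Set.mem_ofPred_eq, Set.mem_empty_iff_false, iff_false]
      rintro ⟨-, -, a, b, -⟩
      exact hY ⟨a, b⟩
  have hfc : Continuous f := by fun_prop
  have hx0 : 0 ≤ x := hy.trans hxy
  rw [Measure.volume_eq_prod, Measure.prod_apply_symm hmeas]
  simp_rw [hfib]
  rw [lintegral_indicator measurableSet_Icc,
    ← ofReal_integral_eq_lintegral_ofReal
      (hfc.integrableOn_Icc) ((ae_restrict_iff' measurableSet_Icc).2 (ae_of_all _ hf0)),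
    ENNReal.toReal_ofReal (setIntegral_nonneg measurableSet_Icc hf0),
    integral_Icc_eq_integral_Ioc, ← intervalIntegral.integral_of_le hx0]
  have i1 : ∫ Y in (0:ℝ)..x, max 0 (e * (y - Y)) = e * y ^ 2 / 2 := by
    rw [← intervalIntegral.integral_add_adjacent_intervals (b := y)
      (Continuous.intervalIntegrable (by fun_prop) _ _)
      (Continuous.intervalIntegrable (by fun_prop) _ _)]
    have e1 : ∫ Y in (0:ℝ)..y, max 0 (e * (y - Y)) = ∫ Y in (0:ℝ)..y, e * (y - Y) := by
      apply intervalIntegral.integral_congr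
      intro Y hY
      rw [Set.uIcc_of_le hy] at hY
      exact max_eq_right (mul_nonneg he (by linarith [hY.2]))
    have e2 : ∫ Y in y..x, max 0 (e * (y - Y)) = ∫ Y in y..x, (0:ℝ) := by
      apply intervalIntegral.integral_congr
      intro Y hY
      rw [Set.uIcc_of_le hxy] at hY
      exact max_eq_left (mul_nonpos_of_nonneg_of_nonpos he (by linarith [hY.1]))
    rw [e1, e2, intervalIntegral.integral_const_mul, intervalIntegral.integral_sub
      (Continuous.intervalIntegrable (by fun_prop) _ _)
      (Continuous.intervalIntegrable (by fun_prop) _ _)]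
    simp
    ring
  have i2 : ∫ Y in (0:ℝ)..x, max 0 (e * (Y - (x - y))) = e * y ^ 2 / 2 := by
    have := intervalIntegral.integral_comp_sub_left (a := 0) (b := x)
      (fun Y => max 0 (e * (y - Y))) x
    simp only [sub_self, sub_zero] at this
    rw [i1] at this
    rw [← this]
    congr 1; ext Y; congr 2; ring
  simp only [f]
  rw [intervalIntegral.integral_sub (Continuous.intervalIntegrable (by fun_prop) _ _)
      (Continuous.intervalIntegrable (by fun_prop) _ _),
    intervalIntegral.integral_sub (Continuous.intervalIntegrable (by fun_prop) _ _)
      (Continuous.intervalIntegrable (by fun_prop) _ _), i1, i2]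
  simp
  ring

theorem hexa_add (e w x y w' x' y' : ℝ) (he : 0 ≤ e) (hy : 0 ≤ y) (hxy : y ≤ x)
    (hw : e * y ≤ w) (hy' : 0 ≤ y') (hxy' : y' ≤ x') (hw' : e * y' ≤ w') :
    hexa e w x y + hexa e w' x' y' = hexa e (w + w') (x + x') (y + y') := by
  apply Set.Subset.antisymm
  · rintro _ ⟨⟨p1, p2⟩, ⟨a1, a2, a3, a4, a5, a6⟩, ⟨q1, q2⟩, ⟨b1, b2, b3, b4, b5, b6⟩, rfl⟩
    simp only [hexa, Set.mem_ofPred_eq, Prod.mk_add_mk] at *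
    refine ⟨?_, ?_, ?_, ?_, ?_, ?_⟩ <;> nlinarith
  · rw [← hull_eq e (w + w') (x + x') (y + y') he (by linarith) (by linarith) (by linarith)]
    apply convexHull_min _ ((hexa_convex e w x y).add (hexa_convex e w' x' y'))
    rw [← hull_eq e w x y he hy hxy hw, ← hull_eq e w' x' y' he hy' hxy' hw']
    have key : ∀ p ∈ verts e w x y, ∀ q ∈ verts e w' x' y', p + q ∈
        convexHull ℝ (verts e w x y) + convexHull ℝ (verts e w' x' y') := fun p hp q hq =>
      Set.add_mem_add (subset_convexHull ℝ _ hp) (subset_convexHull ℝ _ hq)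
    rintro p (rfl | rfl | rfl | rfl | rfl | rfl)
    · convert key (0, y) (by simp [verts]) (0, y') (by simp [verts]) using 1; simp
    · convert key (0, x) (by simp [verts]) (0, x') (by simp [verts]) using 1; simp
    · convert key (e * y, 0) (by simp [verts]) (e * y', 0) (by simp [verts]) using 1
      simp; ring
    · convert key (w, 0) (by simp [verts]) (w', 0) (by simp [verts]) using 1; simp
    · convert key (w, x - y) (by simp [verts]) (w', x' - y') (by simp [verts]) using 1
      simp; ring
    · convert key (w - e * y, x) (by simp [verts]) (w' - e * y', x') (by simp [verts]) using 1
      simp; ring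

theorem image_verts (d b e x y : ℤ) :
    toR2 '' {(0, y), (0, x), (e * y, 0),
      (d * x + b * y, 0), (d * x + b * y, x - y), (d * x + (b - e) * y, x)} =
    verts e (d * x + b * y) x y := by
  have : (d * x + (b - e) * y : ℝ) = d * x + b * y - e * y := by ring
  simp [Set.image_insert_eq, toR2, verts, this]

/-- For integers `d, e ≥ 0` and `b` with `d + b - e ≥ 0`, and
integers `x₁ ≥ y₁ ≥ 0`, `x₂ ≥ y₂ ≥ 0`, the hexagons
`Pᵢ = conv{(0,yᵢ),(0,xᵢ),(eyᵢ,0),(dxᵢ+byᵢ,0),(dxᵢ+byᵢ,xᵢ-yᵢ),(dxᵢ+(b-e)yᵢ,xᵢ)}`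
have normalized mixed volume `V(P₁,P₂) = 2d x₁x₂ + b(x₁y₂+x₂y₁) - 2e y₁y₂`. -/
theorem stmt_12 (d b e x₁ y₁ x₂ y₂ : ℤ) (hd : 0 ≤ d) (he : 0 ≤ e)
    (hdbe : 0 ≤ d + b - e) (h1 : x₁ ≥ y₁) (h1' : y₁ ≥ 0)
    (h2 : x₂ ≥ y₂) (h2' : y₂ ≥ 0)
    (P₁ P₂ : Set (ℝ × ℝ))
    (hP₁ : P₁ = convexHull ℝ (toR2 '' {(0, y₁), (0, x₁), (e * y₁, 0),
      (d * x₁ + b * y₁, 0), (d * x₁ + b * y₁, x₁ - y₁), (d * x₁ + (b - e) * y₁, x₁)}))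
    (hP₂ : P₂ = convexHull ℝ (toR2 '' {(0, y₂), (0, x₂), (e * y₂, 0),
      (d * x₂ + b * y₂, 0), (d * x₂ + b * y₂, x₂ - y₂), (d * x₂ + (b - e) * y₂, x₂)})) :
    mixedVol P₁ P₂ =
      (2 * d) * x₁ * x₂ + b * (x₁ * y₂ + x₂ * y₁) - (2 * e) * y₁ * y₂ := by
  rw [image_verts] at hP₁ hP₂
  have aux : ∀ x y : ℤ, x ≥ y → y ≥ 0 → (e : ℝ) * y ≤ d * x + b * y := by
    intro x y h h'
    have : e * y ≤ d * x + b * y := by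
      nlinarith [mul_nonneg hd (sub_nonneg.2 h), mul_nonneg hdbe h']
    exact_mod_cast this
  have w1 := aux x₁ y₁ h1 h1'
  have w2 := aux x₂ y₂ h2 h2'
  have he' : (0 : ℝ) ≤ e := by exact_mod_cast he
  have g1 : (y₁ : ℝ) ≤ x₁ := by exact_mod_cast h1
  have g1' : (0 : ℝ) ≤ y₁ := by exact_mod_cast h1'
  have g2 : (y₂ : ℝ) ≤ x₂ := by exact_mod_cast h2
  have g2' : (0 : ℝ) ≤ y₂ := by exact_mod_cast h2'
  rw [hull_eq _ _ _ _ he' g1' g1 w1] at hP₁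
  rw [hull_eq _ _ _ _ he' g2' g2 w2] at hP₂
  rw [hP₁, hP₂, mixedVol, nvol, nvol, nvol, hexa_add _ _ _ _ _ _ _ he' g1' g1 w1 g2' g2 w2,
    hexa_vol _ _ _ _ he' g1' g1 w1, hexa_vol _ _ _ _ he' g2' g2 w2,
    hexa_vol _ _ _ _ he' (by linarith) (by linarith) (by linarith)]
  ring
end

section
/- For every triple of non-negative integers (A, B, C) with AC ≤ B², there exist two planar tropical curves V_f and V_g intersecting transversally such that the self-intersection number of V_f is A, the intersection number (V_f, V_g) is B, and the self-intersection number of V_g is C. -/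
/-- A (data of a) planar tropical polynomial: a non-empty finite support
`S ⊂ ℤ²` together with real coefficients. -/
structure TropPoly where
  S : Finset (ℤ × ℤ)
  hS : S.Nonempty
  c : ℤ × ℤ → ℝ

namespace TropPoly

/-- Evaluation `f(p) = min {c_{a,b} + a p₁ + b p₂ : (a,b) ∈ S}`. -/
noncomputable def eval (f : TropPoly) (p : ℝ × ℝ) : ℝ :=
  f.S.inf' f.hS fun q => f.c q + (q.1 : ℝ) * p.1 + (q.2 : ℝ) * p.2

/-- The set of support points achieving the minimum at `p`. -/
noncomputable def active (f : TropPoly) (p : ℝ × ℝ) : Finset (ℤ × ℤ) :=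
  f.S.filter fun q => f.c q + (q.1 : ℝ) * p.1 + (q.2 : ℝ) * p.2 = f.eval p

/-- The tropical curve `V_f`: the non-differentiability locus of `f`, i.e.
the points where the minimum is attained at least twice. -/
noncomputable def curve (f : TropPoly) : Set (ℝ × ℝ) :=
  {p | 1 < (f.active p).card}

/-- `p` lies in the relative interior of an edge of `V_f`, and `v, w` are the
endpoints of the dual edge of the induced subdivision (so that `w - v` equals
the weight of the edge times a primitive vector orthogonal to its direction):
the active support points at `p` all lie on the segment from `v` to `w`. -/
def IsEdgePoint (f : TropPoly) (p : ℝ × ℝ) (v w : ℤ × ℤ) : Prop :=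
  v ∈ f.active p ∧ w ∈ f.active p ∧ v ≠ w ∧
    ∀ q ∈ f.active p,
      (q.1 - v.1) * (w.2 - v.2) = (q.2 - v.2) * (w.1 - v.1) ∧
      0 ≤ (q.1 - v.1) * (w.1 - v.1) + (q.2 - v.2) * (w.2 - v.2) ∧
      (q.1 - v.1) * (w.1 - v.1) + (q.2 - v.2) * (w.2 - v.2) ≤
        (w.1 - v.1) ^ 2 + (w.2 - v.2) ^ 2

/-- `V_f` and `V_g` intersect transversally with total intersection number `n`:
the intersection is finite, each intersection point lies in the relative
interior of an edge of each curve, and the sum of the local intersection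
numbers `w(e)w(h)|det(u,v)|` equals `n`.  (For edges with dual-edge vectors
`w - v` and `w' - v'`, the local number `w(e)w(h)|det(u,v)|` equals
`|det(w - v, w' - v')|`.) -/
noncomputable def TransversalWithNumber (f g : TropPoly) (n : ℤ) : Prop :=
  ∃ T : Finset (ℝ × ℝ), ↑T = f.curve ∩ g.curve ∧
    ∃ m : ℝ × ℝ → ℤ,
      (∀ p ∈ T, ∃ v w v' w' : ℤ × ℤ, IsEdgePoint f p v w ∧ IsEdgePoint g p v' w' ∧
        m p = |(w.1 - v.1) * (w'.2 - v'.2) - (w.2 - v.2) * (w'.1 - v'.1)|) ∧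
      ∑ p ∈ T, m p = n

/-- `f'` is a translate of `f`: same support, coefficients shifted by a linear
function (so `V_{f'}` is a translate of `V_f`). -/
def IsTranslate (f f' : TropPoly) : Prop :=
  f'.S = f.S ∧ ∃ x₀ y₀ : ℝ, ∀ q : ℤ × ℤ,
    f'.c q = f.c q + (q.1 : ℝ) * x₀ + (q.2 : ℝ) * y₀

/-- The self-intersection number of `V_f` is `n`: some translate of `V_f`
meets it transversally with intersection number `n`. -/
noncomputable def SelfIntersection (f : TropPoly) (n : ℤ) : Prop :=
  ∃ f' : TropPoly, IsTranslate f f' ∧ TransversalWithNumber f f' n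

end TropPoly


namespace TropAux

open scoped Pointwise

/-- pairing of an integer vector and a real vector -/
noncomputable def pr (q : ℤ × ℤ) (p : ℝ × ℝ) : ℝ := (q.1 : ℝ) * p.1 + (q.2 : ℝ) * p.2

def ip (q U : ℤ × ℤ) : ℤ := q.1 * U.1 + q.2 * U.2

open Classical in
noncomputable def face (S : Finset (ℤ × ℤ)) (p : ℝ × ℝ) : Finset (ℤ × ℤ) :=
  S.filter fun q => ∀ q' ∈ S, pr q p ≤ pr q' p

lemma mem_face {S : Finset (ℤ × ℤ)} {p : ℝ × ℝ} {q : ℤ × ℤ} :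
    q ∈ face S p ↔ q ∈ S ∧ ∀ q' ∈ S, pr q p ≤ pr q' p := by
  classical
  simp [face]

/-- `U` is a positive multiple of `p` -/
def par (p : ℝ × ℝ) (U : ℤ × ℤ) : Prop :=
  p.1 * (U.2 : ℝ) = p.2 * (U.1 : ℝ) ∧ 0 < p.1 * (U.1 : ℝ) + p.2 * (U.2 : ℝ)

open Classical in
noncomputable def W (L : List (ℤ × ℤ)) (p : ℝ × ℝ) : ℤ × ℤ :=
  (L.map fun U => if par p U then U else 0).sum

def Rep (S : Finset (ℤ × ℤ)) (L : List (ℤ × ℤ)) : Prop :=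
  ∀ p : ℝ × ℝ, p ≠ 0 → ∃ v ∈ face S p, ∃ w ∈ face S p,
    w.1 - v.1 = (W L p).2 ∧ w.2 - v.2 = -(W L p).1 ∧
    ∀ q ∈ face S p,
      0 ≤ ((q.1 - v.1 : ℤ) : ℝ) * p.2 - ((q.2 - v.2 : ℤ) : ℝ) * p.1 ∧
      0 ≤ ((w.1 - q.1 : ℤ) : ℝ) * p.2 - ((w.2 - q.2 : ℤ) : ℝ) * p.1

structure Pol where
  S : Finset (ℤ × ℤ)
  L : List (ℤ × ℤ)
  h : ℤ × ℤ → ℤ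
  rep : Rep S L
  bal : L.sum = 0
  hmem : ∀ U, ∃ q ∈ S, ip q U = h U
  hle : ∀ U, ∀ q ∈ S, h U ≤ ip q U

lemma Pol.ne (P : Pol) : P.S.Nonempty := by
  obtain ⟨q, hq, _⟩ := P.hmem 0
  exact ⟨q, hq⟩

noncomputable def mv (P Q : Pol) : ℤ := -(P.L.map Q.h).sum

lemma W_append (L M : List (ℤ × ℤ)) (p : ℝ × ℝ) : W (L ++ M) p = W L p + W M p := by
  simp [W]

lemma pr_add (a b : ℤ × ℤ) (p : ℝ × ℝ) : pr (a + b) p = pr a p + pr b p := by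
  simp [pr]; ring

lemma ip_add (a b : ℤ × ℤ) (p : ℤ × ℤ) : ip (a + b) p = ip a p + ip b p := by
  simp [ip]; ring

lemma face_add_mem {S T : Finset (ℤ × ℤ)} {p : ℝ × ℝ} {a b : ℤ × ℤ}
    (ha : a ∈ face S p) (hb : b ∈ face T p) : a + b ∈ face (S + T) p := by
  rw [mem_face] at *
  refine ⟨Finset.add_mem_add ha.1 hb.1, ?_⟩
  intro q' hq'
  obtain ⟨c, hc, d, hd, rfl⟩ := Finset.mem_add.1 hq'
  rw [pr_add, pr_add]
  linarith [ha.2 c hc, hb.2 d hd]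

lemma face_add_split {S T : Finset (ℤ × ℤ)} {p : ℝ × ℝ} {q : ℤ × ℤ}
    (hq : q ∈ face (S + T) p) : ∃ a ∈ face S p, ∃ b ∈ face T p, a + b = q := by
  rw [mem_face] at hq
  obtain ⟨hq, hm⟩ := hq
  obtain ⟨a, ha, b, hb, rfl⟩ := Finset.mem_add.1 hq
  refine ⟨a, mem_face.2 ⟨ha, ?_⟩, b, mem_face.2 ⟨hb, ?_⟩, rfl⟩
  · intro c hc
    have := hm _ (Finset.add_mem_add hc hb)
    rw [pr_add, pr_add] at this
    linarith
  · intro c hc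
    have := hm _ (Finset.add_mem_add ha hc)
    rw [pr_add, pr_add] at this
    linarith

lemma Rep.add {S T : Finset (ℤ × ℤ)} {L M : List (ℤ × ℤ)} (h1 : Rep S L) (h2 : Rep T M) :
    Rep (S + T) (L ++ M) := by
  intro p hp
  obtain ⟨v, hv, w, hw, e1, e2, H⟩ := h1 p hp
  obtain ⟨v', hv', w', hw', e1', e2', H'⟩ := h2 p hp
  refine ⟨v + v', face_add_mem hv hv', w + w', face_add_mem hw hw', ?_, ?_, ?_⟩
  · rw [W_append]; simp only [Prod.fst_add, Prod.snd_add]; linarith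
  · rw [W_append]; simp only [Prod.fst_add, Prod.snd_add]; linarith
  · intro q hq
    obtain ⟨a, ha, b, hb, rfl⟩ := face_add_split hq
    have A := H a ha
    have B := H' b hb
    push_cast at A B
    simp only [Prod.fst_add, Prod.snd_add]
    push_cast
    constructor
    · linarith [A.1, B.1]
    · linarith [A.2, B.2]

noncomputable def Pol.add (P Q : Pol) : Pol where
  S := P.S + Q.S
  L := P.L ++ Q.L
  h := fun U => P.h U + Q.h U
  rep := P.rep.add Q.rep
  bal := by rw [List.sum_append, P.bal, Q.bal, add_zero]
  hmem := by
    intro U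
    obtain ⟨a, ha, e⟩ := P.hmem U
    obtain ⟨b, hb, e'⟩ := Q.hmem U
    exact ⟨a + b, Finset.add_mem_add ha hb, by rw [ip_add, e, e']⟩
  hle := by
    intro U q hq
    obtain ⟨a, ha, b, hb, rfl⟩ := Finset.mem_add.1 hq
    rw [ip_add]
    linarith [P.hle U a ha, Q.hle U b hb]

lemma mv_add_left (P Q R : Pol) : mv (P.add Q) R = mv P R + mv Q R := by
  simp [mv, Pol.add]; ring

lemma mv_add_right (P Q R : Pol) : mv R (P.add Q) = mv R P + mv R Q := by
  simp only [mv, Pol.add, List.sum_map_add]; ring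

lemma rep_D (a b : ℤ) (hab : a ≤ b) :
    Rep {((0 : ℤ), a), (0, b), (1, 0)} [(a, 1), (-b, -1), (b - a, 0)] := by
  classical
  rintro ⟨x, y⟩ hp
  have habR : (a : ℝ) ≤ b := by exact_mod_cast hab
  have hF : ∀ q : ℤ × ℤ, q ∈ face {((0 : ℤ), a), (0, b), (1, 0)} (x, y) ↔
      (q = (0, a) ∨ q = (0, b) ∨ q = (1, 0)) ∧
        pr q (x, y) ≤ a * y ∧ pr q (x, y) ≤ b * y ∧ pr q (x, y) ≤ x := by
    intro q
    rw [mem_face]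
    simp [pr]
  have hW : W [(a, 1), (-b, -1), (b - a, 0)] (x, y) =
      (if par (x, y) (a, 1) then (a, 1) else 0) + ((if par (x, y) (-b, -1) then (-b, -1) else 0)
        + (if par (x, y) (b - a, 0) then (b - a, 0) else 0)) := by
    simp [W]
  have P1 : par (x, y) (a, 1) ↔ x = y * a ∧ 0 < y := by
    simp only [par]
    push_cast
    constructor
    · rintro ⟨h1, h2⟩
      have h1 : x = y * a := by linarith
      subst h1
      exact ⟨rfl, by nlinarith [mul_self_nonneg (a : ℝ)]⟩
    · rintro ⟨h1, h2⟩
      subst h1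
      exact ⟨by ring, by nlinarith [mul_self_nonneg (a : ℝ)]⟩
  have P2 : par (x, y) (-b, -1) ↔ x = y * b ∧ y < 0 := by
    simp only [par]
    push_cast
    constructor
    · rintro ⟨h1, h2⟩
      have h1 : x = y * b := by linarith
      subst h1
      exact ⟨rfl, by nlinarith [mul_self_nonneg (b : ℝ)]⟩
    · rintro ⟨h1, h2⟩
      subst h1
      exact ⟨by ring, by nlinarith [mul_self_nonneg (b : ℝ)]⟩
  have P3 : par (x, y) (b - a, 0) ↔ y = 0 ∧ 0 < x ∧ a < b := by
    simp only [par]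
    push_cast
    constructor
    · rintro ⟨h1, h2⟩
      have h3 : a ≠ b := by
        rintro rfl
        simp at h2
      have h4 : a < b := lt_of_le_of_ne hab h3
      have h5 : (0 : ℝ) < b - a := by
        have : (a : ℝ) < b := by exact_mod_cast h4
        linarith
      refine ⟨?_, ?_, h4⟩
      · have : y * ((b : ℝ) - a) = 0 := by linarith
        rcases mul_eq_zero.1 this with h | h
        · exact h
        · linarith
      · by_contra! h
        nlinarith
    · rintro ⟨h1, h2, h3⟩
      subst h1
      have h5 : (0 : ℝ) < b - a := by
        have : (a : ℝ) < b := by exact_mod_cast h3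
        linarith
      exact ⟨by ring, by nlinarith⟩
  simp only [hF, hW, P1, P2, P3]
  rcases lt_trichotomy y 0 with hy | hy | hy
  · have hyab : (b : ℝ) * y ≤ a * y := by nlinarith
    have n1 : ¬ (x = y * a ∧ 0 < y) := fun h => by linarith [h.2]
    have n3 : ¬ (y = 0 ∧ 0 < x ∧ a < b) := fun h => by linarith [h.1]
    rw [if_neg n1, if_neg n3]
    rcases lt_trichotomy x (y * b) with hx | hx | hx
    · rw [if_neg (fun h => by linarith [h.1])]
      refine ⟨(1, 0), ?_, (1, 0), ?_, by simp, by simp, ?_⟩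
      · simp [pr]; constructor <;> linarith
      · simp [pr]; constructor <;> linarith
      · rintro q ⟨rfl | rfl | rfl, h1, h2, h3⟩ <;> simp [pr] at h1 h2 h3 ⊢ <;> exfalso <;> linarith
    · rw [if_pos ⟨hx, hy⟩]
      have hbx : (b : ℝ) * x ≤ 0 := by rw [hx]; nlinarith [mul_self_nonneg (b : ℝ)]
      refine ⟨(1, 0), ?_, (0, b), ?_, by simp, by simp, ?_⟩
      · simp [pr]; constructor <;> linarith
      · simp [pr]; constructor <;> linarith
      · rintro q ⟨rfl | rfl | rfl, h1, h2, h3⟩ <;> simp [pr] at h1 h2 h3 ⊢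
        · have : (b : ℝ) = a := by nlinarith
          rw [← this]
          constructor <;> linarith
        · linarith
        · linarith
    · rw [if_neg (fun h => by linarith [h.1])]
      refine ⟨(0, b), ?_, (0, b), ?_, by simp, by simp, ?_⟩
      · simp [pr]; constructor <;> linarith
      · simp [pr]; constructor <;> linarith
      · rintro q ⟨rfl | rfl | rfl, h1, h2, h3⟩ <;> simp [pr] at h1 h2 h3 ⊢
        · have : (b : ℝ) = a := by nlinarith
          rw [this]
          simp
        · exfalso; linarith
  · subst hy
    have hx0 : x ≠ 0 := by
      rintro rfl
      exact hp rfl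
    rw [if_neg (fun h => lt_irrefl _ h.2), if_neg (fun h => lt_irrefl _ h.2)]
    rcases lt_or_gt_of_ne hx0 with hx | hx
    · rw [if_neg (fun h => by linarith [h.2.1])]
      refine ⟨(1, 0), ?_, (1, 0), ?_, by simp, by simp, ?_⟩
      · simp [pr]; linarith
      · simp [pr]; linarith
      · rintro q ⟨rfl | rfl | rfl, h1, h2, h3⟩ <;> simp [pr] at h1 h2 h3 ⊢ <;> exfalso <;> linarith
    · have e : (if (0 : ℝ) = 0 ∧ 0 < x ∧ a < b then ((b - a, 0) : ℤ × ℤ) else 0) = (b - a, 0) := by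
        split_ifs with h
        · rfl
        · have : ¬ a < b := fun h' => h ⟨rfl, hx, h'⟩
          have : a = b := by omega
          simp [this]; rfl
      rw [e]
      refine ⟨(0, b), ?_, (0, a), ?_, by simp, by simp, ?_⟩
      · simp [pr]; linarith
      · simp [pr]; linarith
      · rintro q ⟨rfl | rfl | rfl, h1, h2, h3⟩ <;> simp [pr] at h1 h2 h3 ⊢
        · nlinarith
        · nlinarith
        · exfalso; linarith
  · have hyab : (a : ℝ) * y ≤ b * y := by nlinarith
    have n1 : ¬ (x = y * b ∧ y < 0) := fun h => by linarith [h.2]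
    have n3 : ¬ (y = 0 ∧ 0 < x ∧ a < b) := fun h => by linarith [h.1]
    rw [if_neg n1, if_neg n3]
    rcases lt_trichotomy x (y * a) with hx | hx | hx
    · rw [if_neg (fun h => by linarith [h.1])]
      refine ⟨(1, 0), ?_, (1, 0), ?_, by simp, by simp, ?_⟩
      · simp [pr]; constructor <;> linarith
      · simp [pr]; constructor <;> linarith
      · rintro q ⟨rfl | rfl | rfl, h1, h2, h3⟩ <;> simp [pr] at h1 h2 h3 ⊢ <;> exfalso <;> linarith
    · rw [if_pos ⟨hx, hy⟩]
      have hax : 0 ≤ (a : ℝ) * x := by rw [hx]; nlinarith [mul_self_nonneg (a : ℝ)]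
      refine ⟨(0, a), ?_, (1, 0), ?_, by simp, by simp, ?_⟩
      · simp [pr]; constructor <;> linarith
      · simp [pr]; constructor <;> linarith
      · rintro q ⟨rfl | rfl | rfl, h1, h2, h3⟩ <;> simp [pr] at h1 h2 h3 ⊢
        · linarith
        · have : (b : ℝ) = a := by nlinarith
          rw [this]
          constructor <;> linarith
        · linarith
    · rw [if_neg (fun h => by linarith [h.1])]
      refine ⟨(0, a), ?_, (0, a), ?_, by simp, by simp, ?_⟩
      · simp [pr]; constructor <;> linarith
      · simp [pr]; constructor <;> linarith
      · rintro q ⟨rfl | rfl | rfl, h1, h2, h3⟩ <;> simp [pr] at h1 h2 h3 ⊢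
        · have : (b : ℝ) = a := by nlinarith
          rw [this]
          simp
        · exfalso; linarith

lemma rep_E (k : ℤ) (hk : 0 ≤ k) :
    Rep {((0 : ℤ), (0 : ℤ)), (0, k)} [(k, 0), (-k, 0)] := by
  classical
  rintro ⟨x, y⟩ hp
  have hkR : (0 : ℝ) ≤ k := by exact_mod_cast hk
  rcases hk.eq_or_lt with h0 | h0
  · subst h0
    have hf : ((0 : ℤ), (0 : ℤ)) ∈ face {((0 : ℤ), (0 : ℤ)), (0, 0)} (x, y) := by
      rw [mem_face]; simp
    refine ⟨(0, 0), hf, (0, 0), hf, by simp [W, par], by simp [W, par], ?_⟩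
    intro q hq
    rw [mem_face] at hq
    simp only [Finset.mem_insert, Finset.mem_singleton, or_self] at hq
    rw [hq.1]; simp
  have h0R : (0 : ℝ) < k := by exact_mod_cast h0
  have hF : ∀ q : ℤ × ℤ, q ∈ face {((0 : ℤ), (0 : ℤ)), (0, k)} (x, y) ↔
      (q = (0, 0) ∨ q = (0, k)) ∧ pr q (x, y) ≤ 0 ∧ pr q (x, y) ≤ k * y := by
    intro q
    rw [mem_face]
    simp [pr]
  have hW : W [(k, 0), (-k, 0)] (x, y) =
      (if par (x, y) (k, 0) then (k, 0) else 0) + (if par (x, y) (-k, 0) then (-k, 0) else 0) := by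
    simp [W]
  have P1 : par (x, y) (k, 0) ↔ y = 0 ∧ 0 < x := by
    simp [par, h0.ne', h0R]
  have P2 : par (x, y) (-k, 0) ↔ y = 0 ∧ x < 0 := by
    simp [par, h0.ne']
    intro h; constructor <;> intro h' <;> nlinarith
  simp only [hF, hW, P1, P2]
  rcases lt_trichotomy y 0 with hy | hy | hy
  · rw [if_neg (fun h => by linarith [h.1]), if_neg (fun h => by linarith [h.1])]
    refine ⟨(0, k), ?_, (0, k), ?_, by simp, by simp, ?_⟩
    · simp [pr]; nlinarith
    · simp [pr]; nlinarith
    · rintro q ⟨rfl | rfl, h1, h2⟩ <;> simp [pr] at h1 h2 ⊢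
      exfalso; nlinarith
  · subst hy
    have hx0 : x ≠ 0 := by
      rintro rfl
      exact hp rfl
    rcases lt_or_gt_of_ne hx0 with hx | hx
    · rw [if_neg (fun h => by linarith [h.2]), if_pos ⟨rfl, hx⟩]
      refine ⟨(0, 0), ?_, (0, k), ?_, by simp, by simp, ?_⟩
      · simp [pr]
      · simp [pr]
      · rintro q ⟨rfl | rfl, h1, h2⟩ <;> simp [pr] at h1 h2 ⊢ <;> nlinarith
    · rw [if_pos ⟨rfl, hx⟩, if_neg (fun h => by linarith [h.2])]
      refine ⟨(0, k), ?_, (0, 0), ?_, by simp, by simp, ?_⟩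
      · simp [pr]
      · simp [pr]
      · rintro q ⟨rfl | rfl, h1, h2⟩ <;> simp [pr] at h1 h2 ⊢ <;> nlinarith
  · rw [if_neg (fun h => by linarith [h.1]), if_neg (fun h => by linarith [h.1])]
    refine ⟨(0, 0), ?_, (0, 0), ?_, by simp, by simp, ?_⟩
    · simp [pr]; nlinarith
    · simp [pr]; nlinarith
    · rintro q ⟨rfl | rfl, h1, h2⟩ <;> simp [pr] at h1 h2 ⊢
      exfalso; nlinarith

noncomputable def polD (a b : ℤ) (hab : a ≤ b) : Pol where
  S := {((0 : ℤ), a), (0, b), (1, 0)}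
  L := [(a, 1), (-b, -1), (b - a, 0)]
  h := fun U => min (min (a * U.2) (b * U.2)) U.1
  rep := rep_D a b hab
  bal := by simp; ring
  hmem := by
    intro U
    rcases min_choice (min (a * U.2) (b * U.2)) U.1 with h | h
    · rcases min_choice (a * U.2) (b * U.2) with h' | h'
      · exact ⟨(0, a), by simp, by rw [h, h']; simp [ip]⟩
      · exact ⟨(0, b), by simp, by rw [h, h']; simp [ip]⟩
    · exact ⟨(1, 0), by simp, by rw [h]; simp [ip]⟩
  hle := by
    intro U q hq
    simp only [Finset.mem_insert, Finset.mem_singleton] at hq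
    rcases hq with rfl | rfl | rfl <;> simp [ip]

noncomputable def polE (k : ℤ) (hk : 0 ≤ k) : Pol where
  S := {((0 : ℤ), (0 : ℤ)), (0, k)}
  L := [(k, 0), (-k, 0)]
  h := fun U => min 0 (k * U.2)
  rep := rep_E k hk
  bal := by simp
  hmem := by
    intro U
    rcases min_choice 0 (k * U.2) with h | h
    · exact ⟨(0, 0), by simp, by rw [h]; simp [ip]⟩
    · exact ⟨(0, k), by simp, by rw [h]; simp [ip]⟩
  hle := by
    intro U q hq
    simp only [Finset.mem_insert, Finset.mem_singleton] at hq
    rcases hq with rfl | rfl <;> simp [ip]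

noncomputable def polO : Pol where
  S := {((0 : ℤ), (0 : ℤ))}
  L := []
  h := fun _ => 0
  rep := by
    intro p hp
    have h0 : ((0 : ℤ), (0 : ℤ)) ∈ face {((0 : ℤ), (0 : ℤ))} p := by
      rw [mem_face]; simp
    refine ⟨(0, 0), h0, (0, 0), h0, by simp [W], by simp [W], ?_⟩
    intro q hq
    rw [mem_face] at hq
    simp only [Finset.mem_singleton] at hq
    rw [hq.1]; simp
  bal := by simp
  hmem := by intro U; exact ⟨(0, 0), by simp, by simp [ip]⟩
  hle := by intro U q hq; simp at hq; rw [hq]; simp [ip]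

lemma mv_DD (a b c d : ℤ) (hab : a ≤ b) (hcd : c ≤ d) :
    mv (polD a b hab) (polD c d hcd) = max b d - min a c := by
  simp [mv, polD]
  omega

lemma mv_DE (a b k : ℤ) (hab : a ≤ b) (hk : 0 ≤ k) :
    mv (polD a b hab) (polE k hk) = k := by
  simp [mv, polD, polE]
  omega

lemma mv_ED (a b k : ℤ) (hab : a ≤ b) (hk : 0 ≤ k) :
    mv (polE k hk) (polD a b hab) = k := by
  simp [mv, polD, polE]
  omega

lemma mv_EE (k l : ℤ) (hk : 0 ≤ k) (hl : 0 ≤ l) :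
    mv (polE k hk) (polE l hl) = 0 := by
  simp [mv, polE]

lemma mv_O_left (P : Pol) : mv polO P = 0 := by simp [mv, polO]

lemma mv_O_right (P : Pol) : mv P polO = 0 := by simp [mv, polO]

def Good (A B C : ℤ) : Prop :=
  ∃ P Q : Pol, mv P P = A ∧ mv P Q = B ∧ mv Q P = B ∧ mv Q Q = C

lemma Good.symm {A B C : ℤ} (h : Good A B C) : Good C B A := by
  obtain ⟨P, Q, h1, h2, h3, h4⟩ := h
  exact ⟨Q, P, h4, h3, h2, h1⟩

lemma good_aux (n : ℕ) : ∀ A B C : ℤ, 0 ≤ A → 0 ≤ B → 0 ≤ C → A * C ≤ B ^ 2 →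
    A + B + C ≤ n → Good A B C := by
  induction n with
  | zero =>
    intro A B C hA hB hC _ hn
    have : A = 0 := by push_cast at hn; omega
    have : B = 0 := by push_cast at hn; omega
    have : C = 0 := by push_cast at hn; omega
    subst A B C
    exact ⟨polO, polO, mv_O_left _, mv_O_left _, mv_O_left _, mv_O_left _⟩
  | succ n ih =>
    have key : ∀ A B C : ℤ, 0 ≤ A → 0 ≤ B → 0 ≤ C → A * C ≤ B ^ 2 →
        A + B + C ≤ (n + 1 : ℕ) → A ≤ C → Good A B C := by
      intro A B C hA hB hC h hn hAC
      have hAB : A ≤ B := by nlinarith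
      rcases hB.eq_or_lt with hB0 | hB0
      · subst hB0
        have : A = 0 := by omega
        subst this
        refine ⟨polO, polD 0 C hC, mv_O_left _, mv_O_left _, mv_O_right _, ?_⟩
        rw [mv_DD]; simp
      by_cases h2 : 2 * B - A ≤ C
      · obtain ⟨P, Q, h1, h2, h3, h4⟩ := ih A (B - A) (C - 2 * B + A) hA (by omega) (by omega)
          (by nlinarith) (by push_cast at hn; omega)
        refine ⟨P, P.add Q, h1, ?_, ?_, ?_⟩
        · rw [mv_add_right]; omega
        · rw [mv_add_left]; omega
        · rw [mv_add_left, mv_add_right, mv_add_right]; omega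
      by_cases h3 : C ≤ B
      · refine ⟨polD 0 A hA, polD (B - C) B (by omega), ?_, ?_, ?_, ?_⟩ <;> rw [mv_DD] <;> omega
      · refine ⟨polD 0 A hA, (polD 0 (2 * B - C) (by omega)).add (polE (C - B) (by omega)),
          ?_, ?_, ?_, ?_⟩
        · rw [mv_DD]; omega
        · rw [mv_add_right, mv_DD, mv_DE]; omega
        · rw [mv_add_left, mv_DD, mv_ED]; omega
        · rw [mv_add_left, mv_add_right, mv_add_right, mv_DD, mv_DE, mv_ED, mv_EE]; omega
    intro A B C hA hB hC h hn
    rcases le_total A C with h' | h'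
    · exact key A B C hA hB hC h hn h'
    · exact (key C B A hC hB hA (by linarith) (by linarith) h').symm

/-- Univariate tropical fundamental theorem. -/
def act (T : Finset (ℤ × ℤ)) (k : ℤ × ℤ → ℤ) (c : ℤ × ℤ → ℝ) (s : ℝ) (q : ℤ × ℤ) : Prop :=
  q ∈ T ∧ ∀ q' ∈ T, c q + k q * s ≤ c q' + k q' * s

lemma act_mono {T : Finset (ℤ × ℤ)} {k : ℤ × ℤ → ℤ} {c : ℤ × ℤ → ℝ} {s t : ℝ} {q q' : ℤ × ℤ}
    (hst : s < t) (h : act T k c s q) (h' : act T k c t q') : k q' ≤ k q := by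
  have h1 := h.2 q' h'.1
  have h2 := h'.2 q h.1
  by_contra! hlt
  have : (k q : ℝ) < k q' := by exact_mod_cast hlt
  nlinarith

lemma next_break {T : Finset (ℤ × ℤ)} {k : ℤ × ℤ → ℤ} {c : ℤ × ℤ → ℝ} {s : ℝ} {q q' : ℤ × ℤ}
    (h : act T k c s q) (hmin : ∀ r, act T k c s r → k q ≤ k r)
    (hq' : q' ∈ T) (hlt : k q' < k q) :
    ∃ t, s < t ∧ act T k c t q ∧ ∃ r, act T k c t r ∧ k r < k q := by
  classical
  obtain ⟨r, hr, hrm⟩ := Finset.exists_min_image (T.filter fun r => k r < k q)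
    (fun r => (c r - c q) / ((k q : ℝ) - k r)) ⟨q', by simp [hq', hlt]⟩
  simp only [Finset.mem_filter] at hr hrm
  set t := (c r - c q) / ((k q : ℝ) - k r) with ht
  have hpos : (0 : ℝ) < (k q : ℝ) - k r := by
    have : (k r : ℝ) < k q := by exact_mod_cast hr.2
    linarith
  have hteq : t * ((k q : ℝ) - k r) = c r - c q := by
    rw [ht]; field_simp
  have hst : s < t := by
    have h1 := h.2 r hr.1
    have h2 : c q + k q * s ≠ c r + k r * s := by
      intro he
      have : act T k c s r := ⟨hr.1, fun x hx => he ▸ h.2 x hx⟩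
      have := hmin r this
      omega
    have h3 := lt_of_le_of_ne h1 h2
    by_contra! hts
    nlinarith
  have hact : act T k c t q := by
    refine ⟨h.1, fun x hx => ?_⟩
    by_cases hx' : k x < k q
    · have h1 := hrm x ⟨hx, hx'⟩
      have hp : (0 : ℝ) < (k q : ℝ) - k x := by
        have : (k x : ℝ) < k q := by exact_mod_cast hx'
        linarith
      rw [le_div_iff₀ hp] at h1
      linarith
    · have h1 := h.2 x hx
      have : (k q : ℝ) ≤ k x := by exact_mod_cast not_lt.1 hx'
      nlinarith
  refine ⟨t, hst, hact, r, ⟨hr.1, fun x hx => ?_⟩, hr.2⟩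
  have := hact.2 x hx
  linarith

lemma uni {T : Finset (ℤ × ℤ)} {k : ℤ × ℤ → ℤ} {c : ℤ × ℤ → ℝ} (d : ℝ → ℤ) (kmin : ℤ)
    (hk : ∃ q ∈ T, k q = kmin) (hk' : ∀ q ∈ T, kmin ≤ k q)
    (n : ℕ) : ∀ (s : ℝ) (q : ℤ × ℤ), 
      (∀ t, s < t → ∃ v w, act T k c t v ∧ act T k c t w ∧
        (∀ r, act T k c t r → k v ≤ k r ∧ k r ≤ k w) ∧ d t = k w - k v) → act T k c s q → 
      (∀ r, act T k c s r → k q ≤ k r) → k q - kmin ≤ n →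
      ∀ F : Finset ℝ, (∀ t ∈ F, s < t) → (∀ t, s < t → d t ≠ 0 → t ∈ F) →
      ∑ t ∈ F, d t = k q - kmin := by
  have zero : ∀ (s : ℝ) (q : ℤ × ℤ), 
      (∀ t, s < t → ∃ v w, act T k c t v ∧ act T k c t w ∧
        (∀ r, act T k c t r → k v ≤ k r ∧ k r ≤ k w) ∧ d t = k w - k v) → act T k c s q → 
      k q = kmin →
      ∀ F : Finset ℝ, (∀ t ∈ F, s < t) → 
      ∑ t ∈ F, d t = k q - kmin := by
    intro s q hd hq he F hF
    rw [he, sub_self]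
    apply Finset.sum_eq_zero
    intro t ht
    obtain ⟨v, w, hv, hw, -, e⟩ := hd t (hF t ht)
    have h1 := act_mono (hF t ht) hq hw
    have h2 := hk' v hv.1
    have h3 := hk' w hw.1
    have h4 := act_mono (hF t ht) hq hv
    omega
  induction n with
  | zero =>
    intro s q hd hq hmin hn F hF _
    have := hk' q hq.1
    exact zero s q hd hq (by push_cast at hn; omega) F hF
  | succ n ih =>
    intro s q hd hq hmin hn F hF hF'
    by_cases he : k q = kmin
    · exact zero s q hd hq he F hF
    obtain ⟨q', hq', hqk⟩ := hk
    have hlt : k q' < k q := by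
      have := hk' q hq.1
      omega
    obtain ⟨t, hst, hat, r, har, hrk⟩ := next_break hq hmin hq' hlt
    obtain ⟨v, w, hv, hw, hvw, e⟩ := hd t hst
    have hwq : k w = k q := le_antisymm (act_mono hst hq hw) (hvw q hat).2
    have hvr := (hvw r har).1
    have htF : t ∈ F := hF' t hst (by omega)
    have hrec := ih t v (fun x hx => hd x (hst.trans hx)) hv (fun x hx => (hvw x hx).1)
      (by push_cast at hn; omega) (F.filter fun x => t < x) (by simp) (by
        intro x hx hx'
        simp only [Finset.mem_filter]
        exact ⟨hF' x (hst.trans hx) hx', hx⟩)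
    have hsplit : ∑ x ∈ F, d x = d t + ∑ x ∈ F.filter (fun x => t < x), d x := by
      have hsub : insert t (F.filter fun x => t < x) ⊆ F := by
        intro x hx
        simp only [Finset.mem_insert, Finset.mem_filter] at hx
        rcases hx with rfl | hx
        · exact htF
        · exact hx.1
      rw [← Finset.sum_subset hsub, Finset.sum_insert (by simp)]
      intro x hxF hx
      simp only [Finset.mem_insert, Finset.mem_filter, not_or, not_and, not_lt] at hx
      have hxt : x < t := lt_of_le_of_ne (hx.2 hxF) hx.1
      have hsx := hF x hxF
      obtain ⟨v', w', hv', hw', -, e'⟩ := hd x hsx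
      have a1 := act_mono hsx hq hw'
      have a2 := act_mono hxt hv' hat
      have a3 := act_mono hxt hw' hat
      have a4 := act_mono hsx hq hv'
      omega
    rw [hsplit, hrec]
    omega


lemma exists_face {S : Finset (ℤ × ℤ)} (hS : S.Nonempty) (p : ℝ × ℝ) : (face S p).Nonempty := by
  obtain ⟨q, hq, h⟩ := Finset.exists_min_image S (fun q => pr q p) hS
  exact ⟨q, mem_face.2 ⟨hq, h⟩⟩

noncomputable def fan (P : Pol) (p0 : ℝ × ℝ) : TropPoly where
  S := P.S
  hS := P.ne
  c := fun q => -pr q p0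

lemma active_fan (P : Pol) (p0 p : ℝ × ℝ) : (fan P p0).active p = face P.S (p - p0) := by
  have hval : ∀ q : ℤ × ℤ, (fan P p0).c q + (q.1 : ℝ) * p.1 + (q.2 : ℝ) * p.2 = pr q (p - p0) := by
    intro q
    simp [fan, pr]; ring
  ext q
  simp only [TropPoly.active, Finset.mem_filter, mem_face, TropPoly.eval, hval]
  refine and_congr_right fun hq => ⟨fun h q' hq' => ?_, fun h => ?_⟩
  · rw [h]
    exact Finset.inf'_le _ hq'
  · exact le_antisymm (Finset.le_inf' _ _ h) (Finset.inf'_le _ hq)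

/-- two vectors orthogonal to the same nonzero vector with the same position agree -/
lemma orth_eq {a b : ℤ} {p : ℝ × ℝ} (hp : p ≠ 0) (h1 : (a : ℝ) * p.1 + b * p.2 = 0)
    (h2 : (a : ℝ) * p.2 - b * p.1 = 0) : a = 0 ∧ b = 0 := by
  have hpp : 0 < p.1 * p.1 + p.2 * p.2 := by
    by_contra! h
    apply hp
    have e1 : p.1 = 0 := by nlinarith [mul_self_nonneg p.1, mul_self_nonneg p.2]
    have e2 : p.2 = 0 := by nlinarith [mul_self_nonneg p.1, mul_self_nonneg p.2]
    exact Prod.ext e1 e2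
  have ha : (a : ℝ) * (p.1 * p.1 + p.2 * p.2) = 0 := by
    linear_combination p.1 * h1 + p.2 * h2
  have hb : (b : ℝ) * (p.1 * p.1 + p.2 * p.2) = 0 := by
    linear_combination p.2 * h1 - p.1 * h2
  constructor
  · rcases mul_eq_zero.1 ha with h | h
    · exact_mod_cast h
    · linarith
  · rcases mul_eq_zero.1 hb with h | h
    · exact_mod_cast h
    · linarith

lemma face_pr_eq {S : Finset (ℤ × ℤ)} {p : ℝ × ℝ} {q v : ℤ × ℤ} (hq : q ∈ face S p)
    (hv : v ∈ face S p) : ((q.1 - v.1 : ℤ) : ℝ) * p.1 + ((q.2 - v.2 : ℤ) : ℝ) * p.2 = 0 := by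
  rw [mem_face] at hq hv
  have h1 := hq.2 v hv.1
  have h2 := hv.2 q hq.1
  simp only [pr] at h1 h2
  push_cast
  linarith

lemma card_face_iff {S : Finset (ℤ × ℤ)} {L : List (ℤ × ℤ)} (hR : Rep S L) {p : ℝ × ℝ}
    (hp : p ≠ 0) : 1 < (face S p).card ↔ W L p ≠ 0 := by
  obtain ⟨v, hv, w, hw, e1, e2, H⟩ := hR p hp
  constructor
  · intro hc h0
    rw [h0] at e1 e2
    simp at e1 e2
    have hall : ∀ q ∈ face S p, q = v := by
      intro q hq
      have h1 := (H q hq).1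
      have h2 := (H q hq).2
      have h3 := face_pr_eq hq hv
      have hwv : w = v := Prod.ext (by omega) (by omega)
      rw [hwv] at h2
      push_cast at h1 h2
      have h4 : ((q.1 - v.1 : ℤ) : ℝ) * p.2 - ((q.2 - v.2 : ℤ) : ℝ) * p.1 = 0 := by
        push_cast; linarith
      obtain ⟨a, b⟩ := orth_eq hp h3 h4
      exact Prod.ext (by omega) (by omega)
    obtain ⟨a, ha, b, hb, hab⟩ := Finset.one_lt_card.1 hc
    exact hab ((hall a ha).trans (hall b hb).symm)
  · intro h0
    refine Finset.one_lt_card.2 ⟨v, hv, w, hw, ?_⟩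
    rintro rfl
    apply h0
    simp at e1 e2
    exact Prod.ext (by simp; omega) (by simp; omega)

/-- Position parameter: points of a face are affinely parametrized. -/
lemma face_between {S : Finset (ℤ × ℤ)} {p : ℝ × ℝ} (hp : p ≠ 0) {q v w : ℤ × ℤ}
    (hq : q ∈ face S p) (hv : v ∈ face S p) (hw : w ∈ face S p)
    (h1 : 0 ≤ ((q.1 - v.1 : ℤ) : ℝ) * p.2 - ((q.2 - v.2 : ℤ) : ℝ) * p.1)
    (h2 : 0 ≤ ((w.1 - q.1 : ℤ) : ℝ) * p.2 - ((w.2 - q.2 : ℤ) : ℝ) * p.1) :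
    ∃ s t : ℝ, 0 ≤ s ∧ 0 ≤ t ∧
      ((q.1 - v.1 : ℤ) : ℝ) = s * p.2 ∧ ((q.2 - v.2 : ℤ) : ℝ) = -(s * p.1) ∧
      ((w.1 - q.1 : ℤ) : ℝ) = t * p.2 ∧ ((w.2 - q.2 : ℤ) : ℝ) = -(t * p.1) := by
  have hpp : 0 < p.1 * p.1 + p.2 * p.2 := by
    by_contra! h
    apply hp
    have e1 : p.1 = 0 := by nlinarith [mul_self_nonneg p.1, mul_self_nonneg p.2]
    have e2 : p.2 = 0 := by nlinarith [mul_self_nonneg p.1, mul_self_nonneg p.2]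
    exact Prod.ext e1 e2
  have o1 := face_pr_eq hq hv
  have o2 := face_pr_eq hw hq
  refine ⟨_, _, div_nonneg h1 hpp.le, div_nonneg h2 hpp.le, ?_, ?_, ?_, ?_⟩
  · rw [div_mul_eq_mul_div, eq_div_iff hpp.ne']
    linear_combination p.1 * o1
  · rw [div_mul_eq_mul_div, ← neg_div, eq_div_iff hpp.ne']
    linear_combination p.2 * o1
  · rw [div_mul_eq_mul_div, eq_div_iff hpp.ne']
    linear_combination p.1 * o2
  · rw [div_mul_eq_mul_div, ← neg_div, eq_div_iff hpp.ne']
    linear_combination p.2 * o2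

lemma edge_point (P : Pol) (p0 p : ℝ × ℝ) (hp : p - p0 ≠ 0) (hW : W P.L (p - p0) ≠ 0) :
    ∃ v w, TropPoly.IsEdgePoint (fan P p0) p v w ∧ w.1 - v.1 = (W P.L (p - p0)).2 ∧
      w.2 - v.2 = -(W P.L (p - p0)).1 := by
  obtain ⟨v, hv, w, hw, e1, e2, H⟩ := P.rep _ hp
  refine ⟨v, w, ⟨?_, ?_, ?_, ?_⟩, e1, e2⟩
  · rw [active_fan]; exact hv
  · rw [active_fan]; exact hw
  · rintro rfl
    apply hW
    simp at e1 e2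
    exact Prod.ext (by simp; omega) (by simp; omega)
  · intro q hq
    rw [active_fan] at hq
    obtain ⟨s, t, hs, ht, a1, a2, a3, a4⟩ := face_between hp hq hv hw (H q hq).1 (H q hq).2
    set x := p - p0
    have b1 : ((w.1 - v.1 : ℤ) : ℝ) = (s + t) * x.2 := by
      push_cast at a1 a3 ⊢; linarith
    have b2 : ((w.2 - v.2 : ℤ) : ℝ) = -((s + t) * x.1) := by
      push_cast at a2 a4 ⊢; linarith
    have hst : 0 ≤ s * t := mul_nonneg hs ht
    have hxx : 0 ≤ x.1 * x.1 + x.2 * x.2 :=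
      add_nonneg (mul_self_nonneg _) (mul_self_nonneg _)
    refine ⟨?_, ?_, ?_⟩
    · have : ((q.1 - v.1 : ℤ) : ℝ) * ((w.2 - v.2 : ℤ) : ℝ)
          = ((q.2 - v.2 : ℤ) : ℝ) * ((w.1 - v.1 : ℤ) : ℝ) := by
        rw [a1, a2, b1, b2]; ring
      exact_mod_cast this
    · have : 0 ≤ ((q.1 - v.1 : ℤ) : ℝ) * ((w.1 - v.1 : ℤ) : ℝ)
          + ((q.2 - v.2 : ℤ) : ℝ) * ((w.2 - v.2 : ℤ) : ℝ) := by
        rw [a1, a2, b1, b2]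
        have : 0 ≤ (s * s + s * t) * (x.1 * x.1 + x.2 * x.2) := by positivity
        linarith
      exact_mod_cast this
    · have : ((q.1 - v.1 : ℤ) : ℝ) * ((w.1 - v.1 : ℤ) : ℝ)
          + ((q.2 - v.2 : ℤ) : ℝ) * ((w.2 - v.2 : ℤ) : ℝ)
          ≤ ((w.1 - v.1 : ℤ) : ℝ) ^ 2 + ((w.2 - v.2 : ℤ) : ℝ) ^ 2 := by
        rw [a1, a2, b1, b2]
        have : 0 ≤ (t * t + s * t) * (x.1 * x.1 + x.2 * x.2) := by positivity
        linarith
      exact_mod_cast this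

noncomputable def dl : ℝ × ℝ := (1, Real.sqrt 2)

lemma dl_generic {U : ℤ × ℤ} (h : dl.1 * (U.2 : ℝ) = dl.2 * (U.1 : ℝ)) : U = 0 := by
  simp only [dl, one_mul] at h
  by_cases h1 : U.1 = 0
  · rw [h1] at h
    simp at h
    exact Prod.ext h1 h
  · exfalso
    have h2 : (U.1 : ℝ) ≠ 0 := by exact_mod_cast h1
    apply irrational_sqrt_two
    refine ⟨(U.2 : ℚ) / U.1, ?_⟩
    push_cast
    rw [div_eq_iff h2, h]

lemma dl_ne : -dl ≠ 0 := by
  intro h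
  have := congrArg Prod.fst h
  simp [dl] at this

lemma par_ne {p : ℝ × ℝ} {U : ℤ × ℤ} (h : par p U) : U ≠ 0 := by
  rintro rfl
  have := h.2
  simp at this

lemma W_ne {L : List (ℤ × ℤ)} {p : ℝ × ℝ} (h : W L p ≠ 0) : ∃ U ∈ L, par p U := by
  by_contra! hc
  apply h
  unfold W
  apply List.sum_eq_zero
  intro x hx
  obtain ⟨U, hU, rfl⟩ := List.mem_map.1 hx
  rw [if_neg (hc U hU)]

lemma W_dl (L : List (ℤ × ℤ)) : W L (-dl) = 0 := by
  by_contra h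
  obtain ⟨U, _, hU⟩ := W_ne h
  apply par_ne hU
  apply dl_generic
  have := hU.1
  simp only [Prod.fst_neg, Prod.snd_neg] at this
  linarith

lemma W_dl' (L : List (ℤ × ℤ)) : W L dl = 0 := by
  by_contra h
  obtain ⟨U, _, hU⟩ := W_ne h
  exact par_ne hU (dl_generic hU.1)

def det (U V : ℤ × ℤ) : ℤ := U.1 * V.2 - U.2 * V.1

open Classical in
lemma abs_det_W (L : List (ℤ × ℤ)) (p : ℝ × ℝ) (V : ℤ × ℤ) :
    |det (W L p) V| = (L.map fun U => if par p U then |det U V| else 0).sum := by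
  have hdet : ∀ U : ℤ × ℤ, par p U →
      (det U V : ℝ) * (p.1 * p.1 + p.2 * p.2) =
        (p.1 * U.1 + p.2 * U.2) * (p.1 * V.2 - p.2 * V.1) := by
    intro U hU
    have := hU.1
    simp only [det]
    push_cast
    linear_combination (-(p.1 * V.1) - p.2 * V.2) * this
  have hpp : ∀ U : ℤ × ℤ, par p U → 0 < p.1 * p.1 + p.2 * p.2 := by
    intro U hU
    by_contra! h
    have e1 : p.1 = 0 := by nlinarith [mul_self_nonneg p.1, mul_self_nonneg p.2]
    have e2 : p.2 = 0 := by nlinarith [mul_self_nonneg p.1, mul_self_nonneg p.2]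
    have := hU.2
    rw [e1, e2] at this
    simp at this
  have hlin : ∀ L : List (ℤ × ℤ),
      det (W L p) V = (L.map fun U => if par p U then det U V else 0).sum := by
    intro L
    induction L with
    | nil => simp [W, det]
    | cons U L ih =>
      have : W (U :: L) p = (if par p U then U else 0) + W L p := by simp [W]
      rw [this, List.map_cons, List.sum_cons, ← ih]
      split_ifs
      · simp [det]; ring
      · simp [det]
  rw [hlin]
  rcases le_total 0 (p.1 * V.2 - p.2 * V.1) with h | h
  · have hs : ∀ U : ℤ × ℤ, par p U → 0 ≤ det U V := by
      intro U hU
      have h1 := hdet U hU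
      have h2 : 0 ≤ (p.1 * U.1 + p.2 * U.2) * (p.1 * V.2 - p.2 * V.1) := mul_nonneg hU.2.le h
      rw [← h1] at h2
      exact_mod_cast nonneg_of_mul_nonneg_left h2 (hpp U hU)
    have e : (fun U => if par p U then |det U V| else 0) =
        fun U => if par p U then det U V else 0 := by
      funext U
      split_ifs with hU
      · exact abs_of_nonneg (hs U hU)
      · rfl
    rw [e]
    apply abs_of_nonneg
    apply List.sum_nonneg
    intro x hx
    obtain ⟨U, _, rfl⟩ := List.mem_map.1 hx
    split_ifs with hU
    · exact hs U hU
    · rfl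
  · have hs : ∀ U : ℤ × ℤ, par p U → det U V ≤ 0 := by
      intro U hU
      have h1 := hdet U hU
      have h2 : (p.1 * U.1 + p.2 * U.2) * (p.1 * V.2 - p.2 * V.1) ≤ 0 :=
        mul_nonpos_of_nonneg_of_nonpos hU.2.le h
      rw [← h1] at h2
      have h3 := hpp U hU
      by_contra! hc
      have : (0 : ℝ) < det U V := by exact_mod_cast hc
      nlinarith
    have e : (fun U => if par p U then |det U V| else 0) =
        fun U => -(if par p U then det U V else 0) := by
      funext U
      split_ifs with hU
      · exact abs_of_nonpos (hs U hU)
      · simp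
    rw [e]
    have e2 : (L.map fun U => -(if par p U then det U V else 0)).sum =
        -(L.map fun U => if par p U then det U V else 0).sum := by
      induction L with
      | nil => simp
      | cons U L ih => simp only [List.map_cons, List.sum_cons, ih]; ring
    rw [e2]
    apply abs_of_nonpos
    have h3 : 0 ≤ (L.map fun U => -(if par p U then det U V else 0)).sum := by
      apply List.sum_nonneg
      intro x hx
      obtain ⟨U, _, rfl⟩ := List.mem_map.1 hx
      split_ifs with hU
      · linarith [hs U hU]
      · simp
    linarith

/-- characterization of the intersection set -/
lemma mem_inter (P Q : Pol) (p0 p : ℝ × ℝ) :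
    p ∈ (fan P p0).curve ∩ (fan Q (p0 + dl)).curve ↔
      p - p0 ≠ 0 ∧ p - (p0 + dl) ≠ 0 ∧ W P.L (p - p0) ≠ 0 ∧ W Q.L (p - (p0 + dl)) ≠ 0 := by
  simp only [TropPoly.curve, Set.mem_inter_iff, Set.mem_ofPred_eq, active_fan]
  by_cases h1 : p - p0 = 0
  · have h2 : p - (p0 + dl) = -dl := by
      rw [← sub_sub, h1, zero_sub]
    rw [h2, card_face_iff Q.rep dl_ne, W_dl]
    simp [h1]
  · by_cases h2 : p - (p0 + dl) = 0
    · have h3 : p - p0 = dl := by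
        rw [← sub_sub] at h2
        exact sub_eq_zero.1 h2
      rw [card_face_iff P.rep h1, h3, W_dl']
      simp
    · rw [card_face_iff P.rep h1, card_face_iff Q.rep h2]
      simp [h1, h2]

lemma inter_finite (P Q : Pol) (p0 : ℝ × ℝ) :
    ((fan P p0).curve ∩ (fan Q (p0 + dl)).curve).Finite := by
  have hsub : (fan P p0).curve ∩ (fan Q (p0 + dl)).curve ⊆
      ⋃ U ∈ {U | U ∈ P.L}, ⋃ V ∈ {V | V ∈ Q.L},
        {p : ℝ × ℝ | par (p - p0) U ∧ par (p - (p0 + dl)) V} := by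
    intro p hp
    rw [mem_inter] at hp
    obtain ⟨U, hU, hU'⟩ := W_ne hp.2.2.1
    obtain ⟨V, hV, hV'⟩ := W_ne hp.2.2.2
    simp only [Set.mem_iUnion]
    exact ⟨U, hU, V, hV, hU', hV'⟩
  refine Set.Finite.subset ?_ hsub
  refine Set.Finite.biUnion (List.finite_toSet _) fun U _ => ?_
  refine Set.Finite.biUnion (List.finite_toSet _) fun V _ => ?_
  apply Set.Subsingleton.finite
  rintro p ⟨a, b⟩ q ⟨a', b'⟩
  have hdet : (U.1 : ℝ) * V.2 - U.2 * V.1 ≠ 0 := by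
    intro h0
    apply par_ne a
    apply dl_generic
    have hV := par_ne b
    have hVV : 0 < (V.1 : ℝ) * V.1 + V.2 * V.2 := by
      by_contra! h
      apply hV
      have e1 : (V.1 : ℝ) = 0 := by nlinarith [mul_self_nonneg (V.1 : ℝ), mul_self_nonneg (V.2 : ℝ)]
      have e2 : (V.2 : ℝ) = 0 := by nlinarith [mul_self_nonneg (V.1 : ℝ), mul_self_nonneg (V.2 : ℝ)]
      exact Prod.ext (by exact_mod_cast e1) (by exact_mod_cast e2)
    have a1 := a.1
    have b1 := b.1
    simp only [Prod.fst_sub, Prod.snd_sub, Prod.fst_add, Prod.snd_add] at a1 b1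
    set y1 := p.1 - (p0.1 + dl.1)
    set y2 := p.2 - (p0.2 + dl.2)
    -- `y` is parallel to `V`, hence to `U`
    have c1 : (y1 * U.2 - y2 * U.1) * ((V.1 : ℝ) * V.1 + V.2 * V.2) = 0 := by
      linear_combination ((U.1 : ℝ) * V.1 + U.2 * V.2) * b1 - (y1 * V.1 + y2 * V.2) * h0
    have c2 : y1 * U.2 - y2 * U.1 = 0 := by
      rcases mul_eq_zero.1 c1 with h | h
      · exact h
      · linarith
    simp only [y1, y2] at c2
    linarith
  have a1 := a.1
  have b1 := b.1
  have a2 := a'.1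
  have b2 := b'.1
  simp only [Prod.fst_sub, Prod.snd_sub, Prod.fst_add, Prod.snd_add] at a1 b1 a2 b2
  have e1 : (p.1 - q.1) * ((U.1 : ℝ) * V.2 - U.2 * V.1) = 0 := by
    linear_combination (-(V.1 : ℝ)) * (a1 - a2) + (U.1 : ℝ) * (b1 - b2)
  have e2 : (p.2 - q.2) * ((U.1 : ℝ) * V.2 - U.2 * V.1) = 0 := by
    linear_combination (-(V.2 : ℝ)) * (a1 - a2) + (U.2 : ℝ) * (b1 - b2)
  apply Prod.ext
  · rcases mul_eq_zero.1 e1 with h | h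
    · linarith
    · exact absurd h hdet
  · rcases mul_eq_zero.1 e2 with h | h
    · linarith
    · exact absurd h hdet

lemma W_eq_of_zero_det {U V : ℤ × ℤ} (h : det U V ≠ 0) : V ≠ 0 := by
  rintro rfl
  simp [det] at h

/-- Contribution of one ray. -/
lemma ray_sum (Q : Pol) (U : ℤ × ℤ) (hU : U ≠ 0) (q0 : ℤ × ℤ) (hq0 : q0 ∈ face Q.S (-dl))
    (F : Finset ℝ) (hF : ∀ s ∈ F, 0 < s)
    (hF' : ∀ s : ℝ, 0 < s → W Q.L (s * U.1 - dl.1, s * U.2 - dl.2) ≠ 0 → s ∈ F) :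
    ∑ s ∈ F, |det U (W Q.L (s * U.1 - dl.1, s * U.2 - dl.2))| = ip q0 U - Q.h U := by
  have hval : ∀ (q : ℤ × ℤ) (s : ℝ), -pr q dl + ((ip q U : ℤ) : ℝ) * s
      = pr q (s * U.1 - dl.1, s * U.2 - dl.2) := by
    intro q s
    simp [pr, ip]; ring
  have hact : ∀ (q : ℤ × ℤ) (s : ℝ), act Q.S (fun q => ip q U) (fun q => -pr q dl) s q ↔
      q ∈ face Q.S (s * U.1 - dl.1, s * U.2 - dl.2) := by
    intro q s
    simp only [act, hval, mem_face]
  have hne : ∀ s : ℝ, ((s * U.1 - dl.1, s * U.2 - dl.2) : ℝ × ℝ) ≠ 0 := by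
    intro s h
    apply hU
    apply dl_generic
    have h1 := congrArg Prod.fst h
    have h2 := congrArg Prod.snd h
    simp at h1 h2
    linear_combination (-(U.2 : ℝ)) * h1 + (U.1 : ℝ) * h2
  have h00 : ((0 * (U.1 : ℝ) - dl.1, 0 * (U.2 : ℝ) - dl.2) : ℝ × ℝ) = -dl := by
    simp [Prod.ext_iff]
  have huniq : ∀ r ∈ face Q.S (-dl), r = q0 := by
    intro r hr
    by_contra hrq
    have : 1 < (face Q.S (-dl)).card := Finset.one_lt_card.2 ⟨r, hr, q0, hq0, hrq⟩
    rw [card_face_iff Q.rep dl_ne, W_dl] at this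
    exact this rfl
  refine uni (T := Q.S) (k := fun q => ip q U) (c := fun q => -pr q dl)
    (fun s => |det U (W Q.L (s * U.1 - dl.1, s * U.2 - dl.2))|) (Q.h U) (Q.hmem U) (Q.hle U)
    (ip q0 U - Q.h U).toNat 0 q0 ?_ ?_ ?_ ?_ F hF ?_
  · intro s hs
    simp only [hact]
    obtain ⟨v, hv, w, hw, e1, e2, H⟩ := Q.rep _ (hne s)
    have hdd : ip w U - ip v U = -det U (W Q.L (s * U.1 - dl.1, s * U.2 - dl.2)) ∨
      ip w U - ip v U = det U (W Q.L (s * U.1 - dl.1, s * U.2 - dl.2)) := by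
      simp only [ip, det]
      first
        | (right; linear_combination U.1 * e1 + U.2 * e2)
        | (left; linear_combination U.1 * e1 + U.2 * e2)
    have hb : ∀ q ∈ face Q.S (s * U.1 - dl.1, s * U.2 - dl.2), ∃ a b : ℝ, 0 ≤ a ∧ 0 ≤ b ∧
        ((ip q U - ip v U : ℤ) : ℝ) = a * (U.2 * dl.1 - U.1 * dl.2) ∧
        ((ip w U - ip q U : ℤ) : ℝ) = b * (U.2 * dl.1 - U.1 * dl.2) := by
      intro q hq
      obtain ⟨a, b, ha, hb, a1, a2, a3, a4⟩ :=
        face_between (hne s) hq hv hw (H q hq).1 (H q hq).2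
      refine ⟨a, b, ha, hb, ?_, ?_⟩
      · push_cast at a1 a2 ⊢
        simp only [ip]
        push_cast
        linear_combination (U.1 : ℝ) * a1 + (U.2 : ℝ) * a2
      · push_cast at a3 a4 ⊢
        simp only [ip]
        push_cast
        linear_combination (U.1 : ℝ) * a3 + (U.2 : ℝ) * a4
    rcases le_total 0 ((U.2 : ℝ) * dl.1 - U.1 * dl.2) with hD | hD
    · have hall : ∀ q ∈ face Q.S (s * U.1 - dl.1, s * U.2 - dl.2),
          ip v U ≤ ip q U ∧ ip q U ≤ ip w U := by
        intro q hq
        obtain ⟨a, b, ha, hb, c1, c2⟩ := hb q hq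
        have d1 : (0 : ℝ) ≤ ((ip q U - ip v U : ℤ) : ℝ) := by rw [c1]; positivity
        have d2 : (0 : ℝ) ≤ ((ip w U - ip q U : ℤ) : ℝ) := by rw [c2]; positivity
        have d1' : 0 ≤ ip q U - ip v U := by exact_mod_cast d1
        have d2' : 0 ≤ ip w U - ip q U := by exact_mod_cast d2
        omega
      refine ⟨v, w, hv, hw, hall, ?_⟩
      have := (hall v hv).2
      rcases hdd with h | h
      · rw [← abs_neg, ← h, abs_of_nonneg (by omega)]
      · rw [← h, abs_of_nonneg (by omega)]
    · have hall : ∀ q ∈ face Q.S (s * U.1 - dl.1, s * U.2 - dl.2),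
          ip w U ≤ ip q U ∧ ip q U ≤ ip v U := by
        intro q hq
        obtain ⟨a, b, ha, hb, c1, c2⟩ := hb q hq
        have d1 : ((ip q U - ip v U : ℤ) : ℝ) ≤ 0 := by
          rw [c1]; exact mul_nonpos_of_nonneg_of_nonpos ha hD
        have d2 : ((ip w U - ip q U : ℤ) : ℝ) ≤ 0 := by
          rw [c2]; exact mul_nonpos_of_nonneg_of_nonpos hb hD
        have d1' : ip q U - ip v U ≤ 0 := by exact_mod_cast d1
        have d2' : ip w U - ip q U ≤ 0 := by exact_mod_cast d2
        omega
      refine ⟨w, v, hw, hv, hall, ?_⟩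
      have := (hall v hv).1
      rcases hdd with h | h
      · rw [← abs_neg, ← h, abs_of_nonpos (by omega)]; ring
      · rw [← h, abs_of_nonpos (by omega)]; ring
  · rw [hact, h00]; exact hq0
  · intro r hr
    rw [hact, h00] at hr
    rw [huniq r hr]
  · exact Int.self_le_toNat _
  · intro s hs hd
    exact hF' s hs (W_eq_of_zero_det (abs_ne_zero.1 hd))

lemma sum_list_comm {α β : Type*} (T : Finset α) (L : List β) (f : α → β → ℤ) :
    ∑ p ∈ T, (L.map (f p)).sum = (L.map fun U => ∑ p ∈ T, f p U).sum := by
  induction L with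
  | nil => simp
  | cons U L ih => simp [Finset.sum_add_distrib, ih]

lemma ip_list (L : List (ℤ × ℤ)) (q : ℤ × ℤ) : (L.map (ip q)).sum = ip q L.sum := by
  induction L with
  | nil => simp [ip]
  | cons U L ih => simp [ih, ip]; ring

lemma list_sub (L : List (ℤ × ℤ)) (f g : ℤ × ℤ → ℤ) :
    (L.map fun U => f U - g U).sum = (L.map f).sum - (L.map g).sum := by
  induction L with
  | nil => simp
  | cons U L ih => simp [ih]; ring

lemma bkk (P Q : Pol) (p0 : ℝ × ℝ) :
    TropPoly.TransversalWithNumber (fan P p0) (fan Q (p0 + dl)) (mv P Q) := by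
  classical
  have hfin := inter_finite P Q p0
  refine ⟨hfin.toFinset, hfin.coe_toFinset,
    fun p => |det (W P.L (p - p0)) (W Q.L (p - (p0 + dl)))|, ?_, ?_⟩
  · intro p hp
    rw [Set.Finite.mem_toFinset, mem_inter] at hp
    obtain ⟨h1, h2, h3, h4⟩ := hp
    obtain ⟨v, w, hE, e1, e2⟩ := edge_point P p0 p h1 h3
    obtain ⟨v', w', hE', e1', e2'⟩ := edge_point Q (p0 + dl) p h2 h4
    refine ⟨v, w, v', w', hE, hE', ?_⟩
    rw [e1, e2, e1', e2']
    simp only [det]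
    congr 1
    ring
  · obtain ⟨q0, hq0⟩ := exists_face Q.ne (-dl)
    simp only [abs_det_W]
    rw [sum_list_comm hfin.toFinset P.L
      (fun p U => if par (p - p0) U then |det U (W Q.L (p - (p0 + dl)))| else 0)]
    have key : ∀ U ∈ P.L, (∑ p ∈ hfin.toFinset,
        if par (p - p0) U then |det U (W Q.L (p - (p0 + dl)))| else 0) = ip q0 U - Q.h U := by
      intro U hUL
      by_cases hU : U = 0
      · subst hU
        obtain ⟨q, _, hq⟩ := Q.hmem 0
        rw [← hq]
        simp [ip, det]
      have hUU : 0 < (U.1 : ℝ) * U.1 + U.2 * U.2 := by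
        by_contra! h
        apply hU
        have e1 : (U.1 : ℝ) = 0 := by
          nlinarith [mul_self_nonneg (U.1 : ℝ), mul_self_nonneg (U.2 : ℝ)]
        have e2 : (U.2 : ℝ) = 0 := by
          nlinarith [mul_self_nonneg (U.1 : ℝ), mul_self_nonneg (U.2 : ℝ)]
        exact Prod.ext (by exact_mod_cast e1) (by exact_mod_cast e2)
      rw [← Finset.sum_filter]
      set G := hfin.toFinset.filter fun p => par (p - p0) U with hG
      let σ : ℝ × ℝ → ℝ := fun p =>
        ((p - p0).1 * U.1 + (p - p0).2 * U.2) / ((U.1 : ℝ) * U.1 + U.2 * U.2)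
      have hσ : ∀ p, par (p - p0) U → σ p * U.1 = (p - p0).1 ∧ σ p * U.2 = (p - p0).2 := by
        intro p hp
        have := hp.1
        simp only [σ]
        constructor
        · rw [div_mul_eq_mul_div, div_eq_iff hUU.ne']
          linear_combination (-(U.2 : ℝ)) * this
        · rw [div_mul_eq_mul_div, div_eq_iff hUU.ne']
          linear_combination (U.1 : ℝ) * this
      have hinj : Set.InjOn σ G := by
        intro p hp q hq hpq
        have h1 := hσ p (Finset.mem_filter.1 hp).2
        have h2 := hσ q (Finset.mem_filter.1 hq).2
        rw [hpq] at h1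
        simp only [Prod.fst_sub, Prod.snd_sub] at h1 h2
        exact Prod.ext (by linarith [h1.1, h2.1]) (by linarith [h1.2, h2.2])
      rw [← ray_sum Q U hU q0 hq0 (G.image σ), Finset.sum_image hinj]
      · apply Finset.sum_congr rfl
        intro p hp
        have h1 := hσ p (Finset.mem_filter.1 hp).2
        rw [h1.1, h1.2]
        congr 3
        apply Prod.ext <;> simp <;> ring
      · intro s hs
        obtain ⟨p, hp, rfl⟩ := Finset.mem_image.1 hs
        exact div_pos (Finset.mem_filter.1 hp).2.2 hUU
      · intro s hs hW
        refine Finset.mem_image.2 ⟨(p0.1 + s * U.1, p0.2 + s * U.2), ?_, ?_⟩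
        · have e1 : ((p0.1 + s * U.1, p0.2 + s * U.2) : ℝ × ℝ) - p0 = (s * U.1, s * U.2) := by
            apply Prod.ext <;> simp
          have e2 : ((p0.1 + s * U.1, p0.2 + s * U.2) : ℝ × ℝ) - (p0 + dl)
              = (s * U.1 - dl.1, s * U.2 - dl.2) := by
            apply Prod.ext <;> simp <;> ring
          have hpar : par (s * U.1, s * U.2) U := by
            refine ⟨by simp only; ring, ?_⟩
            have := mul_pos hs hUU
            simp only
            linarith
          rw [hG, Finset.mem_filter, Set.Finite.mem_toFinset, mem_inter, e1, e2]
          refine ⟨⟨?_, ?_, ?_, hW⟩, hpar⟩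
          · intro h
            have h1 := congrArg Prod.fst h
            have h2 := congrArg Prod.snd h
            have := hpar.2
            simp only [Prod.fst_zero, Prod.snd_zero] at h1 h2
            simp only [h1, h2] at this
            simp at this
          · intro h
            apply hU
            apply dl_generic
            have h1 := congrArg Prod.fst h
            have h2 := congrArg Prod.snd h
            simp only [Prod.fst_zero, Prod.snd_zero] at h1 h2
            linear_combination (-(U.2 : ℝ)) * h1 + (U.1 : ℝ) * h2
          · -- the vector `U` itself contributes to `W`
            intro h0
            have h1 := abs_det_W P.L (s * U.1, s * U.2) (-U.2, U.1)
            rw [h0] at h1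
            have h2 : |det U (-U.2, U.1)| ≤ (P.L.map fun V =>
                if par (s * U.1, s * U.2) V then |det V (-U.2, U.1)| else 0).sum := by
              apply List.single_le_sum
              · intro x hx
                obtain ⟨V, _, rfl⟩ := List.mem_map.1 hx
                split_ifs
                · exact abs_nonneg _
                · rfl
              · refine List.mem_map.2 ⟨U, hUL, ?_⟩
                rw [if_pos hpar]
            rw [← h1] at h2
            have h3 : det U (-U.2, U.1) = U.1 * U.1 + U.2 * U.2 := by simp [det]
            have h4 : (0 : ℤ) < U.1 * U.1 + U.2 * U.2 := by exact_mod_cast hUU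
            rw [h3, abs_of_pos h4] at h2
            simp [det] at h2
            omega
        · simp only [σ]
          rw [div_eq_iff hUU.ne']
          simp
          ring
    rw [List.map_congr_left key, list_sub, ip_list, P.bal, mv]
    simp [ip]

lemma fan_translate (P : Pol) (p0 p1 : ℝ × ℝ) : TropPoly.IsTranslate (fan P p0) (fan P p1) := by
  refine ⟨rfl, p0.1 - p1.1, p0.2 - p1.2, fun q => ?_⟩
  simp [fan, pr]; ring

end TropAux

/-- Given non-negative integers `(A,B,C)` with `AC ≤ B²`, there
exist planar tropical curves `V_f`, `V_g` intersecting transversally such that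
the self-intersection number of `V_f` is `A`, the intersection number
`(V_f, V_g)` is `B`, and the self-intersection number of `V_g` is `C`. -/
theorem stmt_13 (A B C : ℕ) (h : A * C ≤ B ^ 2) :
    ∃ f g : TropPoly,
      TropPoly.TransversalWithNumber f g B ∧
      TropPoly.SelfIntersection f A ∧
      TropPoly.SelfIntersection g C := by
  obtain ⟨P, Q, h1, h2, -, h4⟩ := TropAux.good_aux (A + B + C) A B C (by positivity)
    (by positivity) (by positivity) (by exact_mod_cast h) (by push_cast; exact le_rfl)
  refine ⟨TropAux.fan P 0, TropAux.fan Q (0 + TropAux.dl), ?_, ?_, ?_⟩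
  · rw [← h2]; exact TropAux.bkk P Q 0
  · exact ⟨_, TropAux.fan_translate P 0 (0 + TropAux.dl), h1 ▸ TropAux.bkk P P 0⟩
  · exact ⟨_, TropAux.fan_translate Q _ (0 + TropAux.dl + TropAux.dl), h4 ▸ TropAux.bkk Q Q _⟩
end
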